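/- Let N ≥ 1, let D ⊂ ℂ be a bounded connected smoothly bounded domain, and let f : D̄ → ℂ^N be injective, of class C² on D̄ and holomorphic in D, with nonvanishing derivative on D̄ (the derivative extends continuously to D̄ and is nonzero there). Then the compact set f(D̄) has a basis of open Stein neighborhoods in ℂ^N: for every open set U ⊆ ℂ^N with f(D̄) ⊆ U there is a Stein open set Ω with f(D̄) ⊆ Ω ⊆ U. -/

import Mathlib

open Set Filter Complex Metric

noncomputable section

abbrev Cn (N : ℕ) := EuclideanSpace ℂ (Fin N)

/-- A bounded open set `D ⊆ ℂ` is smoothly bounded. -/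
def SmoothlyBounded (D : Set ℂ) : Prop :=
  ∃ V : Set ℂ, IsOpen V ∧ frontier D ⊆ V ∧
    ∃ v : ℂ → ℝ, ContDiffOn ℝ (⊤ : ℕ∞) v V ∧
      D ∩ V = {z ∈ V | v z < 0} ∧
      frontier D = {z ∈ V | v z = 0} ∧
      ∀ z ∈ frontier D, fderiv ℝ v z ≠ 0

/-- `f` is of class `C^r` on `D̄` and holomorphic in `D`. -/
def ClassA {F : Type*} [NormedAddCommGroup F] [NormedSpace ℂ F] (r : ℕ) (D : Set ℂ)
    (f : ℂ → F) : Prop :=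
  ContinuousOn f (closure D) ∧ DifferentiableOn ℂ f D ∧
  ∀ k ≤ r, ∃ g : ℂ → F, ContinuousOn g (closure D) ∧ EqOn g (iteratedDeriv k f) D

/-- An open set `Ω` in a complex normed space is Stein if it is holomorphically
convex: holomorphically convex hulls of compact subsets are compact. -/
def SteinOpen {E : Type*} [NormedAddCommGroup E] [NormedSpace ℂ E] (Ω : Set E) : Prop :=
  IsOpen Ω ∧ ∀ K : Set E, K ⊆ Ω → IsCompact K →
    IsCompact {z ∈ Ω | ∀ h : E → ℂ, DifferentiableOn ℂ h Ω →
      ‖h z‖ ≤ sSup ((fun w => ‖h w‖) '' K)}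

section CauchyTransform
open MeasureTheory Topology

set_option linter.unusedSectionVars false
variable {E : Type*} [NormedAddCommGroup E] [NormedSpace ℂ E] [CompleteSpace E]

lemma locallyIntegrable_cinv : LocallyIntegrable (fun w : ℂ => w⁻¹) volume := by
  refine locallyIntegrable_of_norm_le_rpow (C := 1) (α := 1) (by simp) (by simp) ?_ ?_
  · filter_upwards with x
    rw [norm_inv, Real.rpow_neg_one]; simp
  · exact measurable_inv.aestronglyMeasurable

lemma integrableOn_polar_of_continuous {F : ℝ × ℝ → E} (hF : Continuous F) (R : ℝ)
    (hR : ∀ p : ℝ × ℝ, R < p.1 → F p = 0) :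
    IntegrableOn F (Ioi (0:ℝ) ×ˢ Ioo (-Real.pi) Real.pi) := by
  have h1 : IntegrableOn F (Icc (0:ℝ) R ×ˢ Icc (-Real.pi) Real.pi) :=
    hF.continuousOn.integrableOn_compact (isCompact_Icc.prod isCompact_Icc)
  have h2 : IntegrableOn F (Ioi R ×ˢ (univ : Set ℝ)) := by
    refine IntegrableOn.congr_fun (f := fun _ => (0:E)) integrableOn_zero ?_
      (measurableSet_Ioi.prod MeasurableSet.univ)
    intro p hp
    exact (hR p hp.1).symm
  refine (h1.union h2).mono_set ?_
  rintro ⟨r, θ⟩ ⟨hr, hθ⟩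
  by_cases h : r ≤ R
  · left; exact ⟨⟨le_of_lt hr, h⟩, ⟨hθ.1.le, hθ.2.le⟩⟩
  · right; exact ⟨not_le.1 h, trivial⟩

lemma cauchy_pompeiu_aux (ψ : ℂ → E) (hψ : ContDiff ℝ 1 ψ) (hc : HasCompactSupport ψ) :
    ∫ w : ℂ, w⁻¹ • (fderiv ℝ ψ w 1 + I • fderiv ℝ ψ w I) = -((2 * Real.pi : ℝ) • ψ 0) := by
  rw [← Complex.integral_comp_polarCoord_symm, polarCoord_target]
  obtain ⟨R, hRpos, hR⟩ := hc.isCompact.isBounded.exists_pos_norm_le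
  have hDcont : Continuous (fderiv ℝ ψ) := hψ.continuous_fderiv one_ne_zero
  let e : ℝ → ℂ := fun θ => Real.cos θ + Real.sin θ * I
  have he : Continuous e := by fun_prop
  have hnorm : ∀ θ, ‖e θ‖ = 1 := by
    intro θ
    have : e θ = Complex.exp (θ * I) := by simp [e, Complex.exp_mul_I]
    rw [this, Complex.norm_exp_ofReal_mul_I]
  have hψ0 : ∀ w : ℂ, R < ‖w‖ → ψ w = 0 := by
    intro w hw
    by_contra h
    exact absurd (hR w (subset_tsupport _ h)) (not_le.2 hw)
  have hD0 : ∀ w : ℂ, R < ‖w‖ → fderiv ℝ ψ w = 0 := by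
    intro w hw
    by_contra h
    have : w ∈ tsupport ψ := support_fderiv_subset ℝ h
    exact absurd (hR w this) (not_le.2 hw)
  let A : ℝ × ℝ → E := fun p => fderiv ℝ ψ ((p.1:ℂ) * e p.2) (e p.2)
  let B : ℝ × ℝ → E := fun p => fderiv ℝ ψ ((p.1:ℂ) * e p.2) (I * e p.2)
  have hA : Continuous A := by
    apply Continuous.clm_apply <;> fun_prop
  have hB : Continuous B := by
    apply Continuous.clm_apply <;> fun_prop
  have hpn : ∀ p : ℝ × ℝ, R < p.1 → R < ‖(p.1:ℂ) * e p.2‖ := by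
    intro p hp
    rw [norm_mul, hnorm, mul_one, Complex.norm_real]
    exact lt_of_lt_of_le hp (le_abs_self _)
  have hA0 : ∀ p : ℝ × ℝ, R < p.1 → A p = 0 := by
    intro p hp; simp only [A]; rw [hD0 _ (hpn p hp)]; rfl
  have hB0 : ∀ p : ℝ × ℝ, R < p.1 → B p = 0 := by
    intro p hp; simp only [B]; rw [hD0 _ (hpn p hp)]; rfl
  have hAi := integrableOn_polar_of_continuous hA R hA0
  have hBi := integrableOn_polar_of_continuous hB R hB0
  have key : ∀ p ∈ Ioi (0:ℝ) ×ˢ Ioo (-Real.pi) Real.pi,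
      p.1 • ((Complex.polarCoord.symm p)⁻¹ • (fderiv ℝ ψ (Complex.polarCoord.symm p) 1
        + I • fderiv ℝ ψ (Complex.polarCoord.symm p) I)) = A p + I • B p := by
    rintro ⟨r, θ⟩ ⟨hr, hθ⟩
    have hr0 : (r:ℂ) ≠ 0 := by exact_mod_cast (ne_of_gt hr)
    rw [Complex.polarCoord_symm_apply]
    simp only [A, B]
    change r • (((r:ℂ) * e θ)⁻¹ • _) = _
    have h1 : ((r:ℂ) * (Real.cos θ + Real.sin θ * I)) = (r:ℂ) * e θ := rfl
    rw [h1]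
    set L := fderiv ℝ ψ ((r:ℂ) * e θ)
    have e1 : e θ = Real.cos θ • (1:ℂ) + Real.sin θ • I := by simp [e]
    have e2 : I * e θ = Real.cos θ • I - Real.sin θ • (1:ℂ) := by
      simp [e]; ring_nf; simp; ring
    have hcs : (Real.cos θ : ℂ) ^ 2 + (Real.sin θ : ℂ) ^ 2 = 1 := by
      exact_mod_cast Real.cos_sq_add_sin_sq θ
    have e3 : (e θ)⁻¹ = Real.cos θ - Real.sin θ * I := by
      rw [inv_eq_iff_eq_inv, eq_comm, inv_eq_iff_eq_inv, eq_comm]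
      apply inv_eq_of_mul_eq_one_left
      simp only [e]
      linear_combination hcs - (Real.sin θ : ℂ)^2 * I_sq
    rw [e2, map_sub, map_smul, map_smul]
    conv_rhs => rw [e1, map_add, map_smul, map_smul]
    rw [mul_inv, e3, ← Complex.coe_smul r, smul_smul, mul_inv_cancel_left₀ hr0]
    simp only [← Complex.coe_smul]
    match_scalars
    · ring
    · push_cast; linear_combination -(Complex.sin θ : ℂ) * I_sq
  rw [setIntegral_congr_fun (measurableSet_Ioi.prod measurableSet_Ioo) key]
  have hBi' : IntegrableOn (fun p => I • B p) (Ioi (0:ℝ) ×ˢ Ioo (-Real.pi) Real.pi) := hBi.smul I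
  rw [integral_add hAi hBi', integral_smul]
  have hIB : ∫ p in Ioi (0:ℝ) ×ˢ Ioo (-Real.pi) Real.pi, B p = 0 := by
    rw [Measure.volume_eq_prod, setIntegral_prod _ (by simpa [Measure.volume_eq_prod] using hBi)]
    refine setIntegral_eq_zero_of_forall_eq_zero ?_
    intro r hr
    have hr0 : r ≠ 0 := ne_of_gt hr
    rw [← integral_Ioc_eq_integral_Ioo, ← intervalIntegral.integral_of_le (by linarith [Real.pi_pos])]
    have : ∀ θ ∈ uIcc (-Real.pi) Real.pi,
        HasDerivAt (fun θ : ℝ => r⁻¹ • ψ ((r:ℂ) * e θ)) (B (r, θ)) θ := by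
      intro θ _
      have h1 : HasDerivAt (fun θ : ℝ => (r:ℂ) * e θ) ((r:ℂ) * (I * e θ)) θ := by
        have hc := (Real.hasDerivAt_cos θ).ofReal_comp
        have hs := (Real.hasDerivAt_sin θ).ofReal_comp
        have := (hc.add (hs.mul_const I)).const_mul (r:ℂ)
        refine HasDerivAt.congr_deriv (f := fun θ : ℝ => (r:ℂ) * e θ) this ?_
        simp only [e]; push_cast; linear_combination -(r:ℂ) * (Complex.sin θ) * I_sq
      have h2 : HasFDerivAt ψ (fderiv ℝ ψ ((r:ℂ) * e θ)) ((r:ℂ) * e θ) :=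
        (hψ.differentiable one_ne_zero _).hasFDerivAt
      have h3 := (h2.comp_hasDerivAt θ h1).const_smul r⁻¹
      refine HasDerivAt.congr_deriv (f := fun θ : ℝ => r⁻¹ • ψ ((r:ℂ) * e θ)) h3 ?_
      simp only [B]
      rw [← smul_eq_mul (r:ℂ) (I * e θ), Complex.coe_smul, map_smul, smul_smul, inv_mul_cancel₀ hr0,
        one_smul]
    rw [intervalIntegral.integral_eq_sub_of_hasDerivAt this]
    · simp [e]
    · exact (hB.comp (by fun_prop : Continuous fun θ : ℝ => (r, θ))).intervalIntegrable _ _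
  have hIA : ∫ p in Ioi (0:ℝ) ×ˢ Ioo (-Real.pi) Real.pi, A p = -((2 * Real.pi : ℝ) • ψ 0) := by
    have hAi' : IntegrableOn A (Ioi (0:ℝ) ×ˢ Ioo (-Real.pi) Real.pi)
      ((volume : Measure ℝ).prod volume) := by simpa [Measure.volume_eq_prod] using hAi
    rw [Measure.volume_eq_prod, ← setIntegral_prod_swap, setIntegral_prod]
    · have : ∀ θ ∈ Ioo (-Real.pi) Real.pi,
          (∫ r in Ioi (0:ℝ), A (Prod.swap (θ, r))) = - ψ 0 := by
        intro θ _
        have hh : ∀ r ∈ Ici (0:ℝ), HasDerivAt (fun r : ℝ => ψ ((r:ℂ) * e θ)) (A (r, θ)) r := by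
          intro r _
          have h1 : HasDerivAt (fun r : ℝ => (r:ℂ) * e θ) (e θ) r := by
            have := (hasDerivAt_id r).ofReal_comp.mul_const (e θ)
            simpa using this
          have h2 : HasFDerivAt ψ (fderiv ℝ ψ ((r:ℂ) * e θ)) ((r:ℂ) * e θ) :=
            (hψ.differentiable one_ne_zero _).hasFDerivAt
          exact h2.comp_hasDerivAt r h1
        have := integral_Ioi_of_hasDerivAt_of_tendsto' (m := 0) hh ?_ ?_
        · simpa using this
        · have h1 : IntegrableOn (fun r => A (r, θ)) (Icc 0 R) :=
            (hA.comp (by fun_prop : Continuous fun r : ℝ => (r, θ))).continuousOn.integrableOn_compact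
              isCompact_Icc
          have h2 : IntegrableOn (fun r => A (r, θ)) (Ioi R) := by
            refine IntegrableOn.congr_fun (f := fun _ => (0:E)) integrableOn_zero ?_ measurableSet_Ioi
            intro r hr; exact (hA0 (r, θ) hr).symm
          refine (h1.union h2).mono_set ?_
          intro r hr
          rcases le_or_gt r R with h | h
          · left; exact ⟨le_of_lt hr, h⟩
          · right; exact h
        · refine tendsto_const_nhds.congr' ?_
          filter_upwards [eventually_gt_atTop R] with r hr
          exact (hψ0 _ (hpn (r, θ) hr)).symm
      rw [setIntegral_congr_fun measurableSet_Ioo this]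
      rw [setIntegral_const]
      simp only [Measure.real, Real.volume_Ioo]
      rw [ENNReal.toReal_ofReal (by linarith [Real.pi_pos])]
      rw [smul_neg]; congr 2; ring
    · exact hAi'.swap
  rw [hIA, hIB]; simp

/-- Solution of the inhomogeneous Cauchy-Riemann equation with bounds. -/
lemma exists_dbar_solution (R : ℝ) : ∃ C : ℝ, 0 ≤ C ∧ ∀ (φ : ℂ → E), ContDiff ℝ 1 φ →
    HasCompactSupport φ → (∀ w, φ w ≠ 0 → ‖w‖ ≤ R) → ∀ M : ℝ, (∀ w, ‖φ w‖ ≤ M) →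
    ∃ u : ℂ → E, Differentiable ℝ u ∧
      (∀ z, fderiv ℝ u z 1 + I • fderiv ℝ u z I = φ z) ∧ ∀ z, ‖z‖ ≤ R → ‖u z‖ ≤ C * M := by
  have hint : IntegrableOn (fun w : ℂ => ‖w⁻¹‖) (closedBall 0 (2 * R)) :=
    (locallyIntegrable_cinv.integrableOn_isCompact (isCompact_closedBall _ _)).norm
  refine ⟨(2 * Real.pi)⁻¹ * ∫ w in closedBall (0:ℂ) (2 * R), ‖w⁻¹‖, ?_, ?_⟩
  · have := Real.pi_pos
    have : 0 ≤ ∫ w in closedBall (0:ℂ) (2 * R), ‖w⁻¹‖ := integral_nonneg (fun _ => norm_nonneg _)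
    positivity
  intro φ hφ hc hsupp M hM
  let Lm : ℂ →L[ℝ] E →L[ℝ] E := ContinuousLinearMap.lsmul ℝ ℂ
  let u0 : ℂ → E := convolution (fun w : ℂ => w⁻¹) φ Lm volume
  have hd : ∀ z, HasFDerivAt u0 (convolution (fun w : ℂ => w⁻¹) (fderiv ℝ φ) (Lm.precompR ℂ) volume z) z :=
    fun z => hc.hasFDerivAt_convolution_right Lm locallyIntegrable_cinv hφ z
  have hM0 : 0 ≤ M := (norm_nonneg _).trans (hM 0)
  have hap : ∀ z h, (convolution (fun w : ℂ => w⁻¹) (fderiv ℝ φ) (Lm.precompR ℂ) volume z) h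
      = ∫ w, w⁻¹ • fderiv ℝ φ (z - w) h := by
    intro z h
    rw [convolution_precompR_apply Lm locallyIntegrable_cinv (hc.fderiv ℝ)
      (hφ.continuous_fderiv one_ne_zero)]
    rfl
  have hint2 : ∀ z h, Integrable (fun w : ℂ => w⁻¹ • fderiv ℝ φ (z - w) h) := by
    intro z h
    have hcs : HasCompactSupport (fun w => fderiv ℝ φ w h) := (hc.fderiv ℝ).comp_left (g := fun L : ℂ →L[ℝ] E => L h) rfl
    exact (hcs.convolutionExists_right Lm locallyIntegrable_cinv
      ((hφ.continuous_fderiv one_ne_zero).clm_apply continuous_const) z)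
  refine ⟨fun z => (2 * Real.pi : ℝ)⁻¹ • u0 z, ?_, ?_, ?_⟩
  · intro z
    exact ((hd z).const_smul _).differentiableAt
  · intro z
    have h1 : fderiv ℝ (fun z => (2 * Real.pi : ℝ)⁻¹ • u0 z) z = _ := ((hd z).const_smul ((2 * Real.pi : ℝ)⁻¹)).fderiv
    rw [h1]
    simp only [_root_.smul_apply]
    have hint3 : Integrable (fun w : ℂ => I • w⁻¹ • fderiv ℝ φ (z - w) I) := (hint2 z I).smul I
    rw [hap, hap, smul_comm I, ← smul_add, ← integral_smul, ← integral_add (hint2 z 1) hint3]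
    have hψ : ContDiff ℝ 1 (fun w => φ (z - w)) := hφ.comp (contDiff_const.sub contDiff_id)
    have hψc : HasCompactSupport (fun w => φ (z - w)) :=
      hc.comp_homeomorph (Homeomorph.subLeft z)
    have := cauchy_pompeiu_aux _ hψ hψc
    have hfd : ∀ w, fderiv ℝ (fun w => φ (z - w)) w = - fderiv ℝ φ (z - w) := by
      intro w
      have := ((hφ.differentiable one_ne_zero (z - w)).hasFDerivAt).comp w ((hasFDerivAt_id w).const_sub z)
      rw [HasFDerivAt.fderiv (f := fun w => φ (z - w)) this]
      ext; simp
    simp only [hfd, _root_.neg_apply, sub_zero] at this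
    have h2 : (∫ w : ℂ, (w⁻¹ • fderiv ℝ φ (z - w) 1 + I • w⁻¹ • fderiv ℝ φ (z - w) I))
        = (2 * Real.pi : ℝ) • φ z := by
      rw [← neg_inj, ← this, ← integral_neg]
      congr 1; ext w
      rw [smul_comm I, ← smul_add, smul_neg, ← neg_add, smul_neg]
    rw [h2, smul_smul, inv_mul_cancel₀ (by positivity), one_smul]
  · intro z hz
    rw [norm_smul, Real.norm_of_nonneg (by positivity), mul_assoc]
    refine mul_le_mul_of_nonneg_left ?_ (by positivity)
    have hu : u0 z = ∫ w, w⁻¹ • φ (z - w) := rfl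
    have hu2 : u0 z = ∫ w in closedBall (0:ℂ) (2 * R), w⁻¹ • φ (z - w) := by
      rw [hu, setIntegral_eq_integral_of_forall_compl_eq_zero]
      intro w hw
      by_cases h : φ (z - w) = 0
      · rw [h, smul_zero]
      · exfalso; apply hw
        rw [mem_closedBall_zero_iff]
        calc ‖w‖ = ‖z - (z - w)‖ := by congr 1; ring
          _ ≤ ‖z‖ + ‖z - w‖ := norm_sub_le _ _
          _ ≤ 2 * R := by linarith [hsupp _ h]
    rw [hu2, ← integral_mul_const]
    refine norm_integral_le_of_norm_le (hint.mul_const M) ?_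
    filter_upwards with w
    rw [norm_smul]
    exact mul_le_mul_of_nonneg_left (hM _) (norm_nonneg _)

end CauchyTransform

section Geometry
open Topology
open scoped Manifold ContDiff

lemma exists_cone {D : Set ℂ} (hDopen : IsOpen D) (hDbdd : Bornology.IsBounded D)
    (hsb : SmoothlyBounded D) :
    ∃ n : ℂ → ℂ, ContDiff ℝ ∞ n ∧ ∃ κ > 0, ∃ s0 > 0, ∀ a ∈ closure D, ∀ s : ℝ, 0 < s → s < s0 →
      ball (a - s * n a) (κ * s) ⊆ D := by
  obtain ⟨V, hV, hfV, v, hv, hDV, hfr, hne⟩ := hsb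
  have hvat : ∀ p ∈ frontier D, ContDiffAt ℝ (⊤ : ℕ∞) v p := fun p hp =>
    hv.contDiffAt (hV.mem_nhds (hfV hp))
  obtain ⟨n, hn⟩ := exists_contMDiffMap_forall_mem_convex_of_local_const (n := (⊤ : ℕ∞)) 𝓘(ℝ, ℂ)
    (t := fun y : ℂ => {w : ℂ | y ∈ frontier D → 0 < fderiv ℝ v y w})
    (by
      intro y w1 h1 w2 h2 a b ha hb hab hy
      have e1 := h1 hy
      have e2 := h2 hy
      simp only [map_add, map_smul, smul_eq_mul]
      rcases ha.eq_or_lt with h | h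
      · have : b = 1 := by linarith
        subst h; subst this; simpa using e2
      · have : 0 ≤ b * fderiv ℝ v y w2 := mul_nonneg hb e2.le
        have : 0 < a * fderiv ℝ v y w1 := mul_pos h e1
        linarith)
    (by
      intro x
      by_cases hx : x ∈ frontier D
      · have h0 := hne x hx
        obtain ⟨w, hw⟩ : ∃ w, 0 < fderiv ℝ v x w := by
          by_contra! hcon
          apply h0
          ext1 w
          have h1 := hcon w
          have h2 := hcon (-w)
          rw [map_neg] at h2
          simp; linarith
        refine ⟨w, ?_⟩
        have hcont : ContinuousAt (fun y => fderiv ℝ v y w) x := by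
          have : ContinuousAt (fderiv ℝ v) x :=
            (hvat x hx).continuousAt_fderiv (by simp)
          exact this.clm_apply continuousAt_const
        filter_upwards [hcont.eventually (lt_mem_nhds hw)] with y hy _
        exact hy
      · refine ⟨0, ?_⟩
        have : (frontier D)ᶜ ∈ 𝓝 x := isClosed_frontier.isOpen_compl.mem_nhds hx
        filter_upwards [this] with y hy hy'
        exact absurd hy' hy)
  have hnc : ContDiff ℝ ∞ n := n.contMDiff.contDiff
  refine ⟨n, hnc, ?_⟩
  have hcomp : IsCompact (closure D) := hDbdd.isCompact_closure
  suffices H : ∃ κ > 0, ∃ s0 > 0, ∀ a ∈ closure D ∩ closure D, ∀ s : ℝ, 0 < s → s < s0 →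
      ball (a - s * n a) (κ * s) ⊆ D by simpa using H
  refine hcomp.induction_on (p := fun S => ∃ κ > (0:ℝ), ∃ s0 > (0:ℝ), ∀ a ∈ S ∩ closure D, ∀ s : ℝ,
      0 < s → s < s0 → ball (a - s * n a) (κ * s) ⊆ D) ?_ ?_ ?_ ?_
  · exact ⟨1, one_pos, 1, one_pos, by simp⟩
  · rintro S T hST ⟨κ, hκ, s0, hs0, h⟩
    exact ⟨κ, hκ, s0, hs0, fun a ha => h a ⟨hST ha.1, ha.2⟩⟩
  · rintro S T ⟨κ, hκ, s0, hs0, h⟩ ⟨κ', hκ', s0', hs0', h'⟩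
    refine ⟨min κ κ', lt_min hκ hκ', min s0 s0', lt_min hs0 hs0', ?_⟩
    rintro a ⟨ha | ha, had⟩ s hs hss
    · exact (ball_subset_ball (mul_le_mul_of_nonneg_right (min_le_left _ _) hs.le)).trans
        (h a ⟨ha, had⟩ s hs (hss.trans_le (min_le_left _ _)))
    · exact (ball_subset_ball (mul_le_mul_of_nonneg_right (min_le_right _ _) hs.le)).trans
        (h' a ⟨ha, had⟩ s hs (hss.trans_le (min_le_right _ _)))
  · intro p hp
    -- n is bounded near p
    have hnb : ∀ᶠ a in 𝓝 p, ‖n a‖ < ‖n p‖ + 1 :=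
      (hnc.continuous.norm.continuousAt).eventually (gt_mem_nhds (by linarith))
    suffices H : ∃ κ > (0:ℝ), ∃ s0 > (0:ℝ), ∃ ρ > (0:ℝ), ∀ a ∈ ball p ρ ∩ closure D, ∀ s : ℝ,
      0 < s → s < s0 → ball (a - s * n a) (κ * s) ⊆ D by
      obtain ⟨κ, hκ, s0, hs0, ρ, hρ, h⟩ := H
      exact ⟨ball p ρ, mem_nhdsWithin_of_mem_nhds (ball_mem_nhds p hρ), κ, hκ, s0, hs0, h⟩
    set B := ‖n p‖ + 2 with hB
    have hB2 : 2 ≤ B := by have := norm_nonneg (n p); linarith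
    have hdist : ∀ κ : ℝ, κ ≤ 1 → ∀ a x : ℂ, ‖n a‖ < ‖n p‖ + 1 → ∀ s : ℝ, 0 < s →
        x ∈ ball (a - s * n a) (κ * s) → ‖x - a‖ ≤ s * B := by
      intro κ hκ a x hna s hs hx
      rw [mem_ball, dist_eq_norm] at hx
      calc ‖x - a‖ = ‖(x - (a - s * n a)) - s * n a‖ := by congr 1; ring
        _ ≤ ‖x - (a - s * n a)‖ + ‖(s:ℂ) * n a‖ := norm_sub_le _ _
        _ ≤ κ * s + s * ‖n a‖ := by
            rw [norm_mul, Complex.norm_real, Real.norm_of_nonneg hs.le]; linarith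
        _ ≤ s * B := by nlinarith
    by_cases hpD : p ∈ D
    · obtain ⟨δ, hδ, hδD⟩ := Metric.isOpen_iff.1 hDopen p hpD
      obtain ⟨ρ1, hρ1, hn1⟩ := Metric.eventually_nhds_iff_ball.1 hnb
      refine ⟨1, one_pos, δ / (2 * B), by positivity, min ρ1 (δ/2), by positivity, ?_⟩
      rintro a ⟨ha, -⟩ s hs hss x hx
      apply hδD
      have h1 := hdist 1 le_rfl a x (hn1 a (ball_subset_ball (min_le_left _ _) ha)) s hs hx
      have h2 : dist a p < δ/2 := lt_of_lt_of_le ha (min_le_right _ _)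
      rw [lt_div_iff₀ (by positivity)] at hss
      rw [mem_ball]
      calc dist x p ≤ dist x a + dist a p := dist_triangle _ _ _
        _ < δ := by rw [dist_eq_norm x a]; linarith
    · have hpf : p ∈ frontier D := by
        rw [hDopen.frontier_eq]; exact ⟨hp, hpD⟩
      set L := fderiv ℝ v p with hL
      set m := L (n p) with hm
      have hmpos : 0 < m := hn p hpf
      have hstrict : HasStrictFDerivAt v L p := (hvat p hpf).hasStrictFDerivAt (by simp)
      have hε : 0 < m / (8 * B) := by positivity
      have h1 := hstrict.isLittleO.def hε
      rw [nhds_prod_eq] at h1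
      obtain ⟨δ, hδ, hδv⟩ : ∃ δ > 0, ∀ x ∈ ball p δ, ∀ y ∈ ball p δ,
          ‖v x - v y - L (x - y)‖ ≤ m / (8 * B) * ‖x - y‖ := by
        rw [← nhds_prod_eq, Metric.eventually_nhds_iff_ball] at h1
        obtain ⟨δ, hδ, h⟩ := h1
        refine ⟨δ, hδ, fun x hx y hy => h (x, y) ?_⟩
        rw [← ball_prod_same]; exact ⟨hx, hy⟩
      obtain ⟨δ', hδ', hδV⟩ := Metric.isOpen_iff.1 hV p (hfV hpf)
      have hLn : ∀ᶠ a in 𝓝 p, m / 2 < L (n a) := by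
        have : ContinuousAt (fun a => L (n a)) p := (L.continuous.comp hnc.continuous).continuousAt
        exact this.eventually (lt_mem_nhds (by show m / 2 < m; linarith))
      obtain ⟨ρ1, hρ1, hn1⟩ := Metric.eventually_nhds_iff_ball.1 (hnb.and hLn)
      set δ0 := min δ δ'
      have hδ0 : 0 < δ0 := lt_min hδ hδ'
      set κ := min 1 (m / (8 * (‖L‖ + 1))) with hκdef
      have hLnn := norm_nonneg L
      have hκ : 0 < κ := lt_min one_pos (by positivity)
      have hκ1 : κ ≤ 1 := min_le_left _ _
      have hκL : ‖L‖ * κ ≤ m / 8 := by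
        have h3 : κ ≤ m / (8 * (‖L‖ + 1)) := min_le_right _ _
        rw [le_div_iff₀ (by positivity)] at h3
        nlinarith
      refine ⟨κ, hκ, δ0 / (2 * B), by positivity, min ρ1 (δ0/2), by positivity, ?_⟩
      rintro a ⟨ha, haD⟩ s hs hss x hx
      obtain ⟨hna, hLa⟩ := hn1 a (ball_subset_ball (min_le_left _ _) ha)
      have hxa := hdist κ hκ1 a x hna s hs hx
      have hap : dist a p < δ0/2 := lt_of_lt_of_le ha (min_le_right _ _)
      rw [lt_div_iff₀ (by positivity)] at hss
      have hxp : dist x p < δ0 := by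
        calc dist x p ≤ dist x a + dist a p := dist_triangle _ _ _
        _ < δ0 := by rw [dist_eq_norm x a]; linarith
      have haV : a ∈ V := hδV (lt_of_lt_of_le (by linarith : dist a p < δ0) (min_le_right _ _))
      have hxV : x ∈ V := hδV (lt_of_lt_of_le hxp (min_le_right _ _))
      have hva : v a ≤ 0 := by
        by_cases haD' : a ∈ D
        · have : a ∈ D ∩ V := ⟨haD', haV⟩
          rw [hDV] at this; exact this.2.le
        · have : a ∈ frontier D := by rw [hDopen.frontier_eq]; exact ⟨haD, haD'⟩
          rw [hfr] at this; exact this.2.le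
      have hest := hδv x (lt_of_lt_of_le hxp (min_le_left _ _)) a
        (lt_of_lt_of_le (by linarith : dist a p < δ0) (min_le_left _ _))
      have hest2 : m / (8 * B) * ‖x - a‖ ≤ m / 8 * s := by
        calc m / (8 * B) * ‖x - a‖ ≤ m / (8 * B) * (s * B) := by gcongr
          _ = m / 8 * s := by field_simp
      have hLx : L (x - a) ≤ -(m/2) * s + m / 8 * s := by
        have e1 : x - a = (x - (a - s * n a)) - s • n a := by
          rw [Complex.real_smul]; ring
        rw [mem_ball, dist_eq_norm] at hx
        have e2 : L (x - (a - s * n a)) ≤ ‖L‖ * (κ * s) := by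
          calc L (x - (a - s * n a)) ≤ ‖L (x - (a - s * n a))‖ := Real.le_norm_self _
            _ ≤ ‖L‖ * ‖x - (a - s * n a)‖ := L.le_opNorm _
            _ ≤ ‖L‖ * (κ * s) := by gcongr
        rw [e1, map_sub, map_smul, smul_eq_mul]
        nlinarith
      have hvx : v x < 0 := by
        have := (Real.le_norm_self _).trans (hest.trans hest2)
        nlinarith
      have : x ∈ D ∩ V := by rw [hDV]; exact ⟨hxV, hvx⟩
      exact this.1

lemma exists_quasiconvex {D : Set ℂ} (hDbdd : Bornology.IsBounded D)
    {n : ℂ → ℂ} (hn : Continuous n) {κ s0 : ℝ} (hκ : 0 < κ) (hs0 : 0 < s0)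
    (hcone : ∀ a ∈ closure D, ∀ s : ℝ, 0 < s → s < s0 → ball (a - s * n a) (κ * s) ⊆ D) :
    ∃ C > 0, ∃ η > 0, ∀ δ ≤ η, ∀ z1 ∈ thickening δ D, ∀ z2 ∈ thickening δ D, ‖z1 - z2‖ < η →
      ∃ w1 w2, segment ℝ z1 w1 ⊆ thickening δ D ∧ segment ℝ w1 w2 ⊆ thickening δ D ∧
        segment ℝ w2 z2 ⊆ thickening δ D ∧ ‖w1 - z1‖ + ‖w2 - w1‖ + ‖z2 - w2‖ ≤ C * ‖z1 - z2‖ := by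
  have hcomp : IsCompact (closure D) := hDbdd.isCompact_closure
  obtain ⟨M, hM0⟩ := hcomp.exists_bound_of_continuousOn hn.continuousOn
  set Mn := max M 0
  have hM : ∀ a ∈ closure D, ‖n a‖ ≤ Mn := fun a ha => (hM0 a ha).trans (le_max_left _ _)
  have hMn : 0 ≤ Mn := le_max_right _ _
  have huc := hcomp.uniformContinuousOn_of_continuous hn.continuousOn
  rw [Metric.uniformContinuousOn_iff] at huc
  obtain ⟨η1, hη1, huc⟩ := huc κ hκ
  refine ⟨4 * Mn / κ + 1, by positivity, min (η1 / 3) (κ * s0 / 2), by positivity, ?_⟩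
  intro δ hδ z1 hz1 z2 hz2 hz
  have hδ1 : δ ≤ η1 / 3 := hδ.trans (min_le_left _ _)
  have hz' : ‖z1 - z2‖ < η1 / 3 := hz.trans_le (min_le_left _ _)
  have hz'' : ‖z1 - z2‖ < κ * s0 / 2 := hz.trans_le (min_le_right _ _)
  obtain ⟨a1, ha1, hd1⟩ := mem_thickening_iff.1 hz1
  obtain ⟨a2, ha2, hd2⟩ := mem_thickening_iff.1 hz2
  rw [dist_eq_norm] at hd1 hd2
  by_cases heq : z1 = z2
  · subst heq
    refine ⟨z1, z1, ?_, ?_, ?_, ?_⟩ <;> simp [hz1]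
  set l := ‖z1 - z2‖ with hl
  have hlpos : 0 < l := norm_pos_iff.2 (sub_ne_zero.2 heq)
  set s := 2 * l / κ with hs
  have hspos : 0 < s := by positivity
  have hss0 : s < s0 := by rw [hs, div_lt_iff₀ hκ]; linarith
  have hκs : κ * s = 2 * l := by rw [hs]; field_simp
  have hnn : ‖n a1 - n a2‖ < κ := by
    have := huc a1 (subset_closure ha1) a2 (subset_closure ha2) ?_
    · rwa [dist_eq_norm] at this
    · rw [dist_eq_norm]
      calc ‖a1 - a2‖ = ‖-(z1 - a1) + (z1 - z2) + (z2 - a2)‖ := by congr 1; ring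
        _ ≤ ‖-(z1 - a1)‖ + ‖z1 - z2‖ + ‖z2 - a2‖ := norm_add₃_le
        _ < η1 := by rw [norm_neg]; linarith
  have hin : ∀ x y : ℂ, ∀ z a : ℂ, ‖z - a‖ < δ → x - y = z - a → y ∈ D → x ∈ thickening δ D := by
    intro x y z a h1 h2 h3
    refine mem_thickening_iff.2 ⟨y, h3, ?_⟩
    rw [dist_eq_norm, h2]; exact h1
  refine ⟨z1 - s * n a1, z2 - s * n a1, ?_, ?_, ?_, ?_⟩
  · rw [segment_eq_image']
    rintro _ ⟨θ, ⟨h0, h1⟩, rfl⟩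
    rcases h0.eq_or_lt with h | h
    · subst h; simpa using hz1
    · refine hin _ (a1 - (θ * s : ℝ) * n a1) z1 a1 hd1 ?_ ?_
      · simp [Complex.real_smul]; ring
      · refine hcone a1 (subset_closure ha1) (θ * s) (by positivity) (by nlinarith) ?_
        exact mem_ball_self (by positivity)
  · rw [segment_eq_image']
    rintro _ ⟨θ, ⟨h0, h1⟩, rfl⟩
    refine hin _ (a1 - s * n a1 + θ * (z2 - z1)) z1 a1 hd1 ?_ ?_
    · simp [Complex.real_smul]
    · refine hcone a1 (subset_closure ha1) s hspos hss0 ?_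
      rw [mem_ball, dist_eq_norm, add_sub_cancel_left, norm_mul, Complex.norm_real,
        Real.norm_of_nonneg h0, norm_sub_rev, hκs, ← hl]
      nlinarith
  · rw [segment_symm, segment_eq_image']
    rintro _ ⟨θ, ⟨h0, h1⟩, rfl⟩
    rcases h0.eq_or_lt with h | h
    · subst h; simpa using hz2
    · refine hin _ (a2 - (θ * s : ℝ) * n a1) z2 a2 hd2 ?_ ?_
      · simp [Complex.real_smul]; ring
      · have hθs : 0 < θ * s := by positivity
        refine hcone a2 (subset_closure ha2) (θ * s) hθs (by nlinarith) ?_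
        rw [mem_ball, dist_eq_norm]
        have : a2 - (θ * s : ℝ) * n a1 - (a2 - (θ * s : ℝ) * n a2) = -((θ * s : ℝ) * (n a1 - n a2)) := by ring
        rw [this, norm_neg, norm_mul, Complex.norm_real, Real.norm_of_nonneg hθs.le, mul_comm]
        exact mul_lt_mul_of_pos_right hnn hθs
  · have e1 : ‖z1 - s * n a1 - z1‖ ≤ s * Mn := by
      rw [sub_sub_cancel_left, norm_neg, norm_mul, Complex.norm_real, Real.norm_of_nonneg hspos.le]
      exact mul_le_mul_of_nonneg_left (hM a1 (subset_closure ha1)) hspos.le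
    have e2 : ‖z2 - s * n a1 - (z1 - s * n a1)‖ = l := by
      rw [sub_sub_sub_cancel_right, norm_sub_rev]
    have e3 : ‖z2 - (z2 - s * n a1)‖ ≤ s * Mn := by
      rw [sub_sub_cancel, norm_mul, Complex.norm_real, Real.norm_of_nonneg hspos.le]
      exact mul_le_mul_of_nonneg_left (hM a1 (subset_closure ha1)) hspos.le
    have e4 : (4 * Mn / κ + 1) * l = s * Mn + l + s * Mn := by
      rw [hs]; field_simp; try ring
    rw [e2, e4]; linarith

end Geometry

section Approx
open Topology
open scoped Manifold ContDiff

variable {E : Type*} [NormedAddCommGroup E] [NormedSpace ℂ E] [CompleteSpace E]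

/-- The almost holomorphic approximant. -/
def preApprox (f : ℂ → E) (n : ℂ → ℂ) (t : ℝ) (z : ℂ) : E :=
  f (z - t * n z) + (t * n z) • deriv f (z - t * n z)

lemma preApprox_hasFDerivAt {D : Set ℂ} (hD : IsOpen D) {f : ℂ → E} (hf : DifferentiableOn ℂ f D)
    {n : ℂ → ℂ} (hn : ContDiff ℝ ∞ n) (t : ℝ) {z : ℂ} (hz : z - t * n z ∈ D) :
    ∃ L : ℂ →L[ℝ] E, HasFDerivAt (preApprox f n t) L z ∧
      ∀ h, L h = h • deriv f (z - t * n z) +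
        (t * n z * (h - t * fderiv ℝ n z h)) • deriv (deriv f) (z - t * n z) := by
  have hfa := hf.analyticOnNhd hD
  have h1 : HasDerivAt f (deriv f (z - t * n z)) (z - t * n z) :=
    (hfa _ hz).differentiableAt.hasDerivAt
  have h2 : HasDerivAt (deriv f) (deriv (deriv f) (z - t * n z)) (z - t * n z) :=
    (hfa.deriv _ hz).differentiableAt.hasDerivAt
  have hn1 : HasFDerivAt n (fderiv ℝ n z) z :=
    (hn.differentiable (by simp) z).hasFDerivAt
  have hq : HasFDerivAt (fun z : ℂ => z - t * n z)
      (ContinuousLinearMap.id ℝ ℂ - (t : ℂ) • fderiv ℝ n z) z :=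
    (hasFDerivAt_id z).sub (hn1.const_mul (t : ℂ))
  have e1 := (h1.hasFDerivAt.restrictScalars ℝ).comp z hq
  have e2 := (h2.hasFDerivAt.restrictScalars ℝ).comp z hq
  have e3 := e1.add ((hn1.const_mul (t : ℂ)).smul e2)
  refine ⟨_, e3, fun h => ?_⟩
  simp
  module

lemma exists_correction {D : Set ℂ} (hD : IsOpen D) {f : ℂ → E} (hf : DifferentiableOn ℂ f D)
    {n : ℂ → ℂ} (hn : ContDiff ℝ ∞ n) (t : ℝ) {W : Set ℂ} (hW : IsOpen W) {R C : ℝ}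
    (hWR : W ⊆ closedBall 0 R)
    (hC : ∀ (φ : ℂ → E), ContDiff ℝ 1 φ → HasCompactSupport φ →
      (∀ w, φ w ≠ 0 → ‖w‖ ≤ R) → ∀ M : ℝ, (∀ w, ‖φ w‖ ≤ M) → ∃ u : ℂ → E,
      Differentiable ℝ u ∧ (∀ z, fderiv ℝ u z 1 + I • fderiv ℝ u z I = φ z) ∧
      ∀ z, ‖z‖ ≤ R → ‖u z‖ ≤ C * M)
    (hWD : ∀ z ∈ W, z - t * n z ∈ D) {M : ℝ} (hM0 : 0 ≤ M)
    (hM : ∀ z ∈ W, ‖(t ^ 2 * n z * (fderiv ℝ n z 1 + I * fderiv ℝ n z I)) •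
      deriv (deriv f) (z - t * n z)‖ ≤ M)
    {P : Set ℂ} (hP : IsClosed P) (hPW : P ⊆ W) :
    ∃ u : ℂ → E, (∀ z, ‖z‖ ≤ R → ‖u z‖ ≤ C * M) ∧
      DifferentiableOn ℂ (fun z => preApprox f n t z - u z) (interior P) := by
  have hfa := hf.analyticOnNhd hD
  obtain ⟨χ, hχ0, hχ1, hχ⟩ := exists_contMDiffMap_zero_one_nhds_of_isClosed (n := (⊤ : ℕ∞)) 𝓘(ℝ, ℂ)
    (hW.isClosed_compl) hP (by rw [disjoint_compl_left_iff_subset]; exact hPW)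
  have hχs : ContDiff ℝ ∞ χ := χ.contMDiff.contDiff
  have hts : tsupport χ ⊆ W := by
    intro x hx
    by_contra hxW
    have := hχ0.filter_mono (nhds_le_nhdsSet (show x ∈ Wᶜ from hxW))
    exact (notMem_tsupport_iff_eventuallyEq.2 this) hx
  set ψ : ℂ → E := fun z => -((t ^ 2 * n z * (fderiv ℝ n z 1 + I * fderiv ℝ n z I)) •
      deriv (deriv f) (z - t * n z)) with hψ
  have hψs : ∀ z ∈ W, ContDiffAt ℝ 1 ψ z := by
    intro z hz
    have h2 : ContDiffAt ℝ 1 (deriv (deriv f)) (z - t * n z) :=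
      ((hfa.deriv.deriv _ (hWD z hz)).contDiffAt (n := 1)).restrict_scalars ℝ
    have hn1 : ContDiff ℝ 1 n := hn.of_le (by exact_mod_cast le_top)
    have hn2 : ContDiff ℝ 1 (fderiv ℝ n) := hn.fderiv_right (m := 1) (by rw [one_add_one_eq_two]; exact WithTop.coe_le_coe.2 le_top)
    have hq : ContDiffAt ℝ 1 (fun z : ℂ => z - t * n z) z := by fun_prop
    have := h2.comp z hq
    refine ContDiffAt.neg (ContDiffAt.smul ?_ this)
    have a1 : ContDiff ℝ 1 (fun z => fderiv ℝ n z 1) := hn2.clm_apply contDiff_const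
    have a2 : ContDiff ℝ 1 (fun z => fderiv ℝ n z I) := hn2.clm_apply contDiff_const
    fun_prop
  have hφ : ContDiff ℝ 1 (fun z => χ z • ψ z) := by
    refine contDiff_iff_contDiffAt.2 fun x => ?_
    by_cases hx : x ∈ tsupport χ
    · exact (hχs.of_le (by exact_mod_cast le_top)).contDiffAt.smul (hψs x (hts hx))
    · have h0 := notMem_tsupport_iff_eventuallyEq.1 hx
      refine (contDiffAt_const (c := (0 : E))).congr_of_eventuallyEq ?_
      filter_upwards [h0] with y hy
      rw [hy]; simp
  have hbd : ∀ x, x ∈ tsupport χ → ‖x‖ ≤ R := fun x hx => by simpa using hWR (hts hx)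
  have hcs : HasCompactSupport χ := by
    refine (isCompact_closedBall (0:ℂ) R).of_isClosed_subset (isClosed_tsupport _) ?_
    intro x hx; simpa using hbd x hx
  obtain ⟨u, hu, hdb, hub⟩ := hC _ hφ (hcs.smul_right) (fun w hw => by
    refine hbd w (subset_tsupport _ ?_)
    exact fun h => hw (by simp [h])) M (fun w => by
      by_cases hw : w ∈ W
      · rw [norm_smul, hψ]
        simp only [norm_neg]
        have h1 := hχ w
        rw [Real.norm_of_nonneg h1.1]
        exact (mul_le_of_le_one_left (norm_nonneg _) h1.2).trans (hM w hw)
      · have : w ∉ tsupport χ := fun h => hw (hts h)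
        rw [image_eq_zero_of_notMem_tsupport this]; simpa using hM0)
  refine ⟨u, hub, fun z hz => ?_⟩
  apply DifferentiableAt.differentiableWithinAt
  have hzP := interior_subset hz
  obtain ⟨L, hL, hLe⟩ := preApprox_hasFDerivAt hD hf hn t (hWD z (hPW hzP))
  rw [differentiableAt_complex_iff_differentiableAt_real]
  have hu1 := (hu z).hasFDerivAt
  have hsub := hL.sub hu1
  refine ⟨hsub.differentiableAt, ?_⟩
  have e := hdb z
  have hone : χ z = 1 := (hχ1.filter_mono (nhds_le_nhdsSet hzP)).self_of_nhds
  rw [hone, one_smul] at e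
  change fderiv ℝ (preApprox f n t - u) z I = I • fderiv ℝ (preApprox f n t - u) z 1
  rw [hsub.fderiv]
  simp only [sub_apply, hLe]
  have e' : fderiv ℝ u z I = -(I • ψ z) + I • fderiv ℝ u z 1 := by
    rw [← e, smul_add, smul_smul, I_mul_I]; module
  rw [e', hψ]
  simp only [smul_neg, smul_add, smul_sub, smul_smul, sub_smul, mul_sub, one_smul, mul_one, neg_neg]
  have := I_mul_I
  match_scalars <;> ring_nf <;> simp [I_sq] <;> ring
end Approx

section Approx2
open Topology
open scoped Manifold ContDiff

variable {E : Type*} [NormedAddCommGroup E] [NormedSpace ℂ E] [CompleteSpace E]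

set_option maxHeartbeats 2000000 in
lemma exists_approximants {D : Set ℂ} (hD : IsOpen D) (hDbdd : Bornology.IsBounded D)
    {n : ℂ → ℂ} (hn : ContDiff ℝ ∞ n) {κ s0 : ℝ} (hκ : 0 < κ) (hs0 : 0 < s0)
    (hcone : ∀ a ∈ closure D, ∀ s : ℝ, 0 < s → s < s0 → ball (a - s * n a) (κ * s) ⊆ D)
    {f : ℂ → E} (hfc : ContinuousOn f (closure D)) (hf : DifferentiableOn ℂ f D)
    {M1 M2 : ℝ} (hM10 : 0 ≤ M1) (hM20 : 0 ≤ M2) (hM1 : ∀ z ∈ D, ‖deriv f z‖ ≤ M1)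
    (hM2 : ∀ z ∈ D, ‖deriv (deriv f) z‖ ≤ M2) :
    ∃ c > 0, ∃ C > 0, ∃ t1 > 0, ∀ t : ℝ, 0 < t → t < t1 → ∃ F : ℂ → E,
      DifferentiableOn ℂ F (thickening (c * t) D) ∧
      (∀ z ∈ closure D, ‖F z - f z‖ ≤ C * t ^ 2) ∧
      ∀ z ∈ thickening (c * t) D, ∃ a ∈ D, ‖z - a‖ ≤ C * t ∧ ‖F z - f a‖ ≤ C * t ∧
        ‖deriv F z - deriv f a‖ ≤ C * t := by
  have hfa := hf.analyticOnNhd hD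
  obtain ⟨R0, hR0⟩ := hDbdd.subset_closedBall 0
  set R := R0 + 1 with hR
  obtain ⟨Mn', hMn'⟩ := (isCompact_closedBall (0:ℂ) R).exists_bound_of_continuousOn
    hn.continuous.continuousOn
  obtain ⟨Ln', hLn'⟩ := (isCompact_closedBall (0:ℂ) R).exists_bound_of_continuousOn
    (hn.continuous_fderiv (by simp)).continuousOn
  obtain ⟨Mn, hMn0, hMn⟩ : ∃ Mn, 0 ≤ Mn ∧ ∀ x ∈ closedBall (0:ℂ) R, ‖n x‖ ≤ Mn :=
    ⟨max Mn' 0, le_max_right _ _, fun x hx => (hMn' x hx).trans (le_max_left _ _)⟩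
  obtain ⟨Ln, hLn0, hLn⟩ : ∃ Ln, 0 ≤ Ln ∧ ∀ x ∈ closedBall (0:ℂ) R, ‖fderiv ℝ n x‖ ≤ Ln :=
    ⟨max Ln' 0, le_max_right _ _, fun x hx => (hLn' x hx).trans (le_max_left _ _)⟩
  have hlip : ∀ x ∈ closedBall (0:ℂ) R, ∀ y ∈ closedBall (0:ℂ) R, ‖n y - n x‖ ≤ Ln * ‖y - x‖ :=
    fun x hx y hy => (convex_closedBall (0:ℂ) R).norm_image_sub_le_of_norm_fderiv_le
      (fun x _ => hn.differentiable (by simp) x) hLn hx hy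
  obtain ⟨CR, hCR0, hCR⟩ := exists_dbar_solution (E := E) R
  set c0 := κ / (2 * (1 + Ln)) with hc0
  have hc0pos : 0 < c0 := by positivity
  have hc0e : c0 * (1 + Ln) = κ / 2 := by rw [hc0]; field_simp
  set Q := 2 * Mn * Ln * M2 with hQ
  have hQ0 : 0 ≤ Q := by positivity
  set A1 := Mn ^ 2 * M2 + CR * Q with hA1
  set A2 := Mn * M1 + CR * Q with hA2
  set A3 := M2 * (1 + Ln) * (c0 / 4 + Mn) + 8 * CR * Q / c0 with hA3
  have hA10 : 0 ≤ A1 := by positivity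
  have hA20 : 0 ≤ A2 := by positivity
  have hA30 : 0 ≤ A3 := by positivity
  refine ⟨c0 / 4, by positivity, A1 + A2 + A3 + Mn + 1, by positivity,
    min s0 (min 1 (1 / c0)), by positivity, fun t ht0 ht => ?_⟩
  have hts0 : t < s0 := ht.trans_le (min_le_left _ _)
  have ht1 : t < 1 := ht.trans_le ((min_le_right _ _).trans (min_le_left _ _))
  have htc : c0 * t < 1 := by
    have : t < 1 / c0 := ht.trans_le ((min_le_right _ _).trans (min_le_right _ _))
    rw [lt_div_iff₀ hc0pos] at this; linarith
  have hDR : D ⊆ closedBall 0 R := hR0.trans (closedBall_subset_closedBall (by linarith))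
  set W := thickening (c0 * t) D with hWdef
  have hWR : W ⊆ closedBall 0 R := by
    intro z hz
    obtain ⟨a, ha, hza⟩ := mem_thickening_iff.1 hz
    have := hR0 ha
    rw [mem_closedBall] at this ⊢
    linarith [dist_triangle z a 0]
  have hWD : ∀ z ∈ W, z - t * n z ∈ D := by
    intro z hz
    obtain ⟨a, ha, hza⟩ := mem_thickening_iff.1 hz
    refine hcone a (subset_closure ha) t ht0 hts0 ?_
    rw [dist_eq_norm] at hza
    have h1 := hlip a (hDR ha) z (hWR hz)
    rw [mem_ball, dist_eq_norm]
    calc ‖z - t * n z - (a - t * n a)‖ = ‖(z - a) - t * (n z - n a)‖ := by congr 1; ring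
      _ ≤ ‖z - a‖ + ‖t * (n z - n a)‖ := norm_sub_le _ _
      _ = ‖z - a‖ + t * ‖n z - n a‖ := by
        rw [norm_mul, Complex.norm_real, Real.norm_of_nonneg ht0.le]
      _ ≤ ‖z - a‖ + 1 * (Ln * ‖z - a‖) := by gcongr
      _ = (1 + Ln) * ‖z - a‖ := by ring
      _ ≤ (1 + Ln) * (c0 * t) := by gcongr
      _ = κ / 2 * t := by rw [← hc0e]; ring
      _ < κ * t := by nlinarith
  have hMbd : ∀ z ∈ W, ‖(t ^ 2 * n z * (fderiv ℝ n z 1 + I * fderiv ℝ n z I)) •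
      deriv (deriv f) (z - t * n z)‖ ≤ t ^ 2 * Q := by
    intro z hz
    have h1 : ‖fderiv ℝ n z 1 + I * fderiv ℝ n z I‖ ≤ 2 * Ln := by
      refine (norm_add_le _ _).trans ?_
      have e1 := (fderiv ℝ n z).le_of_opNorm_le (hLn z (hWR hz)) 1
      have e2 := (fderiv ℝ n z).le_of_opNorm_le (hLn z (hWR hz)) I
      rw [norm_mul]
      simp at e1 e2 ⊢
      linarith
    rw [norm_smul, norm_mul, norm_mul, norm_pow, Complex.norm_real, Real.norm_of_nonneg ht0.le]
    calc _ ≤ t ^ 2 * Mn * (2 * Ln) * M2 := by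
          gcongr
          · exact hMn z (hWR hz)
          · exact hM2 _ (hWD z hz)
      _ = _ := by rw [hQ]; ring
  obtain ⟨u, hu, hdiff⟩ := exists_correction hD hf hn t isOpen_thickening hWR hCR hWD
    (by positivity) hMbd (P := cthickening (c0 * t / 2) D) isClosed_cthickening
    (cthickening_subset_thickening' (by positivity) (by nlinarith [mul_pos hc0pos ht0]) _)
  have hct : 0 < c0 * t := by positivity
  have hsubP : thickening (c0 * t / 2) D ⊆ interior (cthickening (c0 * t / 2) D) :=
    thickening_subset_interior_cthickening _ _
  set F : ℂ → E := fun z => preApprox f n t z - u z with hF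
  have hFd : DifferentiableOn ℂ F (thickening (c0 * t / 2) D) := hdiff.mono hsubP
  have hsub4 : thickening (c0 / 4 * t) D ⊆ thickening (c0 * t / 2) D :=
    thickening_mono (by linarith) _
  have hsubW : thickening (c0 * t / 2) D ⊆ W := thickening_mono (by linarith) _
  have huW : ∀ z ∈ W, ‖u z‖ ≤ CR * (t ^ 2 * Q) := fun z hz => hu z (by simpa using hWR hz)
  have hclD : closure D ⊆ thickening (c0 * t / 2) D := by
    rw [closure_eq_iInter_thickening]
    exact iInter₂_subset (c0 * t / 2) (by positivity)
  refine ⟨F, hFd.mono hsub4, ?_, ?_⟩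
  · have key : ∀ z ∈ D, ‖F z - f z‖ ≤ (A1 + A2 + A3 + Mn + 1) * t ^ 2 := by
      intro z hz
      have hzD : ∀ s ∈ Icc (0:ℝ) t, z - s * n z ∈ D := by
        intro s hs
        rcases hs.1.eq_or_lt with h | h
        · subst h; simpa using hz
        · exact hcone z (subset_closure hz) s h (hs.2.trans_lt hts0)
            (mem_ball_self (by positivity))
      have hder : ∀ s ∈ Icc (0:ℝ) t, HasDerivWithinAt
          (fun s : ℝ => f (z - s * n z) + ((s : ℂ) * n z) • deriv f (z - s * n z))
          (-(((s : ℂ) * n z ^ 2) • deriv (deriv f) (z - s * n z))) (Icc 0 t) s := by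
        intro s hs
        have h1 : HasDerivAt f (deriv f (z - s * n z)) (z - s * n z) :=
          (hfa _ (hzD s hs)).differentiableAt.hasDerivAt
        have h2 : HasDerivAt (deriv f) (deriv (deriv f) (z - s * n z)) (z - s * n z) :=
          (hfa.deriv _ (hzD s hs)).differentiableAt.hasDerivAt
        have hm : HasDerivAt (fun s : ℝ => (s : ℂ) * n z) (n z) s := by
          simpa using (Complex.ofRealCLM.hasDerivAt (x := s)).mul_const (n z)
        have hq : HasDerivAt (fun s : ℝ => z - s * n z) (-n z) s := hm.const_sub z
        have e1 := h1.scomp s hq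
        have e2 := h2.scomp s hq
        have e3 := e1.add (hm.smul e2)
        refine (e3.congr_deriv ?_).hasDerivWithinAt
        simp only [smul_smul, Function.comp_apply]
        module
      have hmv := (convex_Icc (0:ℝ) t).norm_image_sub_le_of_norm_hasDerivWithin_le
        (C := t * Mn ^ 2 * M2) hder (fun s hs => by
          rw [norm_neg, norm_smul, norm_mul, norm_pow, Complex.norm_real, Real.norm_of_nonneg hs.1]
          gcongr
          · exact hs.2
          · exact hMn z (hDR hz)
          · exact hM2 _ (hzD s hs)) (left_mem_Icc.2 ht0.le) (right_mem_Icc.2 ht0.le)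
      simp only [ofReal_zero, zero_mul, sub_zero, zero_smul, add_zero,
        Real.norm_of_nonneg ht0.le] at hmv
      have hzW : z ∈ W := hsubW (hclD (subset_closure hz))
      calc ‖F z - f z‖ = ‖(preApprox f n t z - f z) - u z‖ := by simp only [hF]; congr 1; abel
        _ ≤ ‖preApprox f n t z - f z‖ + ‖u z‖ := norm_sub_le _ _
        _ ≤ t * Mn ^ 2 * M2 * t + CR * (t ^ 2 * Q) := add_le_add hmv (huW z hzW)
        _ = A1 * t ^ 2 := by rw [hA1]; ring
        _ ≤ _ := by
          gcongr; linarith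
    intro z hz
    refine le_on_closure key ?_ continuousOn_const hz
    exact ((hFd.continuousOn.mono hclD).sub hfc).norm
  · intro z hz
    have hzW : z ∈ W := hsubW (hsub4 hz)
    have hnz := hMn z (hWR hzW)
    have htsq : t ^ 2 ≤ t := by nlinarith
    refine ⟨z - t * n z, hWD z hzW, ?_, ?_, ?_⟩
    · rw [sub_sub_cancel, norm_mul, Complex.norm_real, Real.norm_of_nonneg ht0.le, mul_comm]
      gcongr; linarith
    · calc ‖F z - f (z - t * n z)‖ = ‖(t * n z) • deriv f (z - t * n z) - u z‖ := by
            rw [hF]; simp only [preApprox]; congr 1; abel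
        _ ≤ ‖(t * n z) • deriv f (z - t * n z)‖ + ‖u z‖ := norm_sub_le _ _
        _ ≤ t * Mn * M1 + CR * (t * Q) := by
          rw [norm_smul, norm_mul, Complex.norm_real, Real.norm_of_nonneg ht0.le]
          refine add_le_add ?_ ((huW z hzW).trans ?_)
          · gcongr
            exact hM1 _ (hWD z hzW)
          · gcongr
        _ = A2 * t := by rw [hA2]; ring
        _ ≤ _ := by gcongr; linarith
    · set ρ := c0 * t / 4 with hρ
      have hρ0 : 0 < ρ := by positivity
      have hball : closedBall z ρ ⊆ thickening (c0 * t / 2) D := by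
        intro w hw
        obtain ⟨a, ha, hza⟩ := mem_thickening_iff.1 hz
        refine mem_thickening_iff.2 ⟨a, ha, ?_⟩
        rw [mem_closedBall] at hw
        linarith [dist_triangle w z a]
      have hballW := hball.trans hsubW
      have hf1lip : ∀ w ∈ closedBall z ρ,
          ‖deriv f (w - t * n w) - deriv f (z - t * n z)‖ ≤ M2 * (1 + Ln) * ρ := by
        intro w hw
        have hh : ∀ w ∈ closedBall z ρ, ‖ContinuousLinearMap.id ℝ ℂ - (t : ℂ) • fderiv ℝ n w‖ ≤ 1 + Ln := by
          intro w hw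
          refine (norm_sub_le _ _).trans (add_le_add ContinuousLinearMap.norm_id_le ?_)
          rw [norm_smul, Complex.norm_real, Real.norm_of_nonneg ht0.le]
          calc _ ≤ 1 * Ln := by
                gcongr
                exact hLn w (hWR (hballW hw))
            _ = _ := one_mul _
        have := (convex_closedBall z ρ).norm_image_sub_le_of_norm_hasFDerivWithin_le
          (f := fun w => deriv f (w - t * n w)) (C := M2 * (1 + Ln))
          (f' := fun w => ((ContinuousLinearMap.toSpanSingleton ℂ (deriv (deriv f) (w - t * n w))).restrictScalars ℝ).comp
            (ContinuousLinearMap.id ℝ ℂ - (t : ℂ) • fderiv ℝ n w)) ?_ ?_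
            (mem_closedBall_self hρ0.le) hw
        · refine this.trans ?_
          gcongr
          simpa [dist_eq_norm] using hw
        · intro w hw
          have h2 : HasDerivAt (deriv f) (deriv (deriv f) (w - t * n w)) (w - t * n w) :=
            (hfa.deriv _ (hWD w (hballW hw))).differentiableAt.hasDerivAt
          have hn1 : HasFDerivAt n (fderiv ℝ n w) w :=
            (hn.differentiable (by simp) w).hasFDerivAt
          have hq : HasFDerivAt (fun z : ℂ => z - t * n z)
              (ContinuousLinearMap.id ℝ ℂ - (t : ℂ) • fderiv ℝ n w) w :=
            (hasFDerivAt_id w).sub (hn1.const_mul (t : ℂ))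
          exact ((h2.hasFDerivAt.restrictScalars ℝ).comp w hq).hasFDerivWithinAt
        · intro w hw
          refine (ContinuousLinearMap.opNorm_comp_le _ _).trans ?_
          refine mul_le_mul ?_ (hh w hw) (norm_nonneg _) hM20
          rw [ContinuousLinearMap.norm_restrictScalars, ContinuousLinearMap.norm_toSpanSingleton]
          exact hM2 _ (hWD w (hballW hw))
      set v := deriv f (z - t * n z) with hv
      set B := M2 * (1 + Ln) * ρ + t * Mn * (1 + Ln) * M2 with hB
      have hB0 : 0 ≤ B := by positivity
      choose! L hL hLe using fun w (hw : w ∈ closedBall z ρ) =>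
        preApprox_hasFDerivAt hD hf hn t (hWD w (hballW hw))
      have hpre : ∀ w ∈ closedBall z ρ,
          ‖preApprox f n t w - preApprox f n t z - (w - z) • v‖ ≤ B * ρ := by
        intro w hw
        have := (convex_closedBall z ρ).norm_image_sub_le_of_norm_hasFDerivWithin_le'
          (f := preApprox f n t) (C := B) (f' := L)
          (φ := (ContinuousLinearMap.toSpanSingleton ℂ v).restrictScalars ℝ)
          (fun w hw => (hL w hw).hasFDerivWithinAt) ?_ (mem_closedBall_self hρ0.le) hw
        · refine this.trans ?_
          gcongr
          simpa [dist_eq_norm] using hw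
        · intro w hw
          refine ContinuousLinearMap.opNorm_le_bound _ hB0 fun h => ?_
          have e : (L w - (ContinuousLinearMap.toSpanSingleton ℂ v).restrictScalars ℝ) h =
              h • (deriv f (w - t * n w) - v) +
              (t * n w * (h - t * fderiv ℝ n w h)) • deriv (deriv f) (w - t * n w) := by
            rw [sub_apply, hLe w hw]
            simp
            module
          rw [e]
          refine (norm_add_le _ _).trans ?_
          rw [norm_smul, norm_smul, norm_mul, norm_mul, Complex.norm_real, Real.norm_of_nonneg ht0.le]
          have e1 : ‖h - t * fderiv ℝ n w h‖ ≤ (1 + Ln) * ‖h‖ := by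
            refine (norm_sub_le _ _).trans ?_
            rw [norm_mul, Complex.norm_real, Real.norm_of_nonneg ht0.le]
            have := (fderiv ℝ n w).le_of_opNorm_le (hLn w (hWR (hballW hw))) h
            nlinarith [norm_nonneg (fderiv ℝ n w h)]
          calc _ ≤ ‖h‖ * (M2 * (1 + Ln) * ρ) + t * Mn * ((1 + Ln) * ‖h‖) * M2 := by
                gcongr
                · exact hf1lip w hw
                · exact hMn w (hWR (hballW hw))
                · exact hM2 _ (hWD w (hballW hw))
            _ = B * ‖h‖ := by rw [hB]; ring
      have hG : ∀ w ∈ sphere z ρ, ‖F w - F z - (w - z) • v‖ ≤ B * ρ + 2 * (CR * (t ^ 2 * Q)) := by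
        intro w hw
        have hw' := sphere_subset_closedBall hw
        calc ‖F w - F z - (w - z) • v‖ =
            ‖(preApprox f n t w - preApprox f n t z - (w - z) • v) - u w + u z‖ := by
              simp only [hF]; congr 1; abel
          _ ≤ ‖(preApprox f n t w - preApprox f n t z - (w - z) • v) - u w‖ + ‖u z‖ := norm_add_le _ _
          _ ≤ ‖(preApprox f n t w - preApprox f n t z - (w - z) • v)‖ + ‖u w‖ + ‖u z‖ := by
              gcongr; exact norm_sub_le _ _
          _ ≤ B * ρ + CR * (t ^ 2 * Q) + CR * (t ^ 2 * Q) := by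
              gcongr
              · exact hpre w hw'
              · exact huW w (hballW hw')
              · exact huW z hzW
          _ = _ := by ring
      have hop : IsOpen (thickening (c0 * t / 2) D) := isOpen_thickening
      have hGd : DifferentiableOn ℂ (fun w => F w - F z - (w - z) • v) (thickening (c0 * t / 2) D) :=
        (hFd.sub_const _).sub (((differentiable_id.sub_const z).smul_const v).differentiableOn)
      have hGc : DiffContOnCl ℂ (fun w => F w - F z - (w - z) • v) (ball z ρ) := by
        refine DifferentiableOn.diffContOnCl (hGd.mono ?_)
        rwa [closure_ball _ hρ0.ne']
      have hCa := Complex.norm_deriv_le_of_forall_mem_sphere_norm_le hρ0 hGc hG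
      have hFz : HasDerivAt F (deriv F z) z :=
        ((hFd z (hsub4 hz)).differentiableAt (hop.mem_nhds (hsub4 hz))).hasDerivAt
      have hGz : HasDerivAt (fun w => F w - F z - (w - z) • v) (deriv F z - v) z := by
        have := (hFz.sub_const (F z)).sub (((hasDerivAt_id z).sub_const z).smul_const v)
        exact this.congr_deriv (by simp)
      rw [hGz.deriv] at hCa
      refine hCa.trans ?_
      have : (B * ρ + 2 * (CR * (t ^ 2 * Q))) / ρ = A3 * t := by
        rw [hB, hA3, hρ]; field_simp; ring
      rw [this]
      gcongr; linarith
end Approx2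

section Bezout
open Topology

/-- Restrictions to `K` of functions holomorphic near `K`. -/
def holoNear (K : Set ℂ) : Subalgebra ℂ C(K, ℂ) where
  carrier := {h | ∃ V : Set ℂ, IsOpen V ∧ K ⊆ V ∧ ∃ g : ℂ → ℂ, DifferentiableOn ℂ g V ∧
    ∀ z : K, h z = g z}
  mul_mem' := by
    rintro a b ⟨V, hV, hK, g, hg, hag⟩ ⟨V', hV', hK', g', hg', hag'⟩
    exact ⟨V ∩ V', hV.inter hV', subset_inter hK hK', fun z => g z * g' z,
      (hg.mono inter_subset_left).mul (hg'.mono inter_subset_right), fun z => by simp [hag, hag']⟩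
  add_mem' := by
    rintro a b ⟨V, hV, hK, g, hg, hag⟩ ⟨V', hV', hK', g', hg', hag'⟩
    exact ⟨V ∩ V', hV.inter hV', subset_inter hK hK', fun z => g z + g' z,
      (hg.mono inter_subset_left).add (hg'.mono inter_subset_right), fun z => by simp [hag, hag']⟩
  algebraMap_mem' := by
    intro r
    exact ⟨univ, isOpen_univ, subset_univ _, fun _ => r, differentiableOn_const _, fun z => rfl⟩

lemma exists_bezout {K : Set ℂ} (hK : IsCompact K) {N : ℕ} (φ : Fin N → ℂ → ℂ)
    (hφc : ∀ i, ContinuousOn (φ i) K)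
    (happ : ∀ i, ∀ ε > 0, ∃ V : Set ℂ, IsOpen V ∧ K ⊆ V ∧ ∃ h : ℂ → ℂ, DifferentiableOn ℂ h V ∧
      ∀ z ∈ K, ‖h z - φ i z‖ ≤ ε)
    (hz : ∀ z ∈ K, ∃ i, φ i z ≠ 0) {ε : ℝ} (hε : 0 < ε) :
    ∃ V : Set ℂ, IsOpen V ∧ K ⊆ V ∧ ∃ g : Fin N → ℂ → ℂ, (∀ i, DifferentiableOn ℂ (g i) V) ∧
      ∀ z ∈ K, ‖∑ i, g i z * φ i z - 1‖ < ε := by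
  haveI : CompactSpace K := isCompact_iff_compactSpace.1 hK
  set S := holoNear K with hS
  set A := S.topologicalClosure with hA
  haveI : CompleteSpace A := (S.isClosed_topologicalClosure).completeSpace_coe
  let Φ0 : Fin N → C(K, ℂ) := fun i => ⟨K.restrict (φ i), (hφc i).restrict⟩
  have hΦ : ∀ i, Φ0 i ∈ A := by
    intro i
    change Φ0 i ∈ closure (S : Set C(K, ℂ))
    rw [Metric.mem_closure_iff]
    intro ε hε
    obtain ⟨V, hV, hKV, h, hh, hb⟩ := happ i (ε / 2) (by positivity)
    refine ⟨⟨K.restrict h, (hh.continuousOn.mono hKV).restrict⟩, ⟨V, hV, hKV, h, hh, fun z => rfl⟩, ?_⟩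
    refine lt_of_le_of_lt ?_ (half_lt_self hε)
    rw [ContinuousMap.dist_le (by positivity)]
    intro z
    rw [dist_comm, dist_eq_norm]
    exact hb z z.2
  let Φ : Fin N → A := fun i => ⟨Φ0 i, hΦ i⟩
  have htop : Ideal.span (range Φ) = ⊤ := by
    by_contra hne
    obtain ⟨M, hM, hIM⟩ := Ideal.exists_le_maximal _ hne
    have hzero : ∀ i, Ideal.toCharacterSpace M (Φ i) = 0 := fun i =>
      Ideal.toCharacterSpace_apply_eq_zero_of_mem M (hIM (Ideal.subset_span (mem_range_self i)))
    set χ : A →ₐ[ℂ] ℂ := WeakDual.CharacterSpace.toAlgHom (Ideal.toCharacterSpace M) with hχ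
    have hzero' : ∀ i, χ (Φ i) = 0 := hzero
    have hle : S ≤ A := S.le_topologicalClosure
    let mk : ∀ (V : Set ℂ) (hV : IsOpen V) (hKV : K ⊆ V) (g : ℂ → ℂ) (hg : DifferentiableOn ℂ g V), A :=
      fun V hV hKV g hg => ⟨⟨K.restrict g, (hg.continuousOn.mono hKV).restrict⟩,
        hle ⟨V, hV, hKV, g, hg, fun z => rfl⟩⟩
    let Z : A := mk univ isOpen_univ (subset_univ _) (fun z => z) differentiableOn_id
    set p := χ Z with hp
    have hpK : p ∈ K := by
      by_contra hpK
      let J : A := mk {p}ᶜ isOpen_compl_singleton (fun x hx h => hpK (by rw [← (show x = p from h)]; exact hx))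
        (fun z => (z - p)⁻¹) (by
          intro z hz
          exact ((differentiableAt_id.sub_const p).inv (sub_ne_zero.2 hz)).differentiableWithinAt)
      have hJ : (Z - algebraMap ℂ A p) * J = 1 := by
        apply Subtype.ext
        ext z
        have : (z : ℂ) - p ≠ 0 := fun h => hpK (by rw [← sub_eq_zero.1 h]; exact z.2)
        exact mul_inv_cancel₀ this
      have := congrArg χ hJ
      rw [map_mul, map_sub, AlgHom.commutes, map_one, ← hp] at this
      simp at this
    have hev : ∀ s : A, (s : C(K, ℂ)) ∈ S → χ s = (s : C(K, ℂ)) ⟨p, hpK⟩ := by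
      rintro s ⟨V, hV, hKV, g, hg, hsg⟩
      have hgd : DifferentiableOn ℂ (dslope g p) V :=
        (differentiableOn_dslope (hV.mem_nhds (hKV hpK))).2 hg
      let J : A := mk V hV hKV _ hgd
      have hJ : s = algebraMap ℂ A (g p) + (Z - algebraMap ℂ A p) * J := by
        apply Subtype.ext
        ext z
        have h1 : g z = g p + ((z : ℂ) - p) * dslope g p z := by
          have := sub_smul_dslope g p z
          rw [smul_eq_mul] at this
          rw [this]; ring
        rw [hsg z]
        exact h1
      rw [hsg ⟨p, hpK⟩]
      conv_lhs => rw [hJ]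
      rw [map_add, map_mul, map_sub, AlgHom.commutes, AlgHom.commutes, ← hp]
      simp
    have hev' : ∀ s : A, χ s = (s : C(K, ℂ)) ⟨p, hpK⟩ := by
      intro a
      refine eq_of_forall_dist_le fun ε hε => ?_
      have h1 : (a : C(K, ℂ)) ∈ closure (S : Set C(K, ℂ)) := a.2
      obtain ⟨s, hs, hd⟩ := Metric.mem_closure_iff.1 h1 (ε / (‖(1 : A)‖ + 1)) (by positivity)
      let s' : A := ⟨s, hle hs⟩
      have h2 := hev s' hs
      have h3 : ‖χ (a - s')‖ ≤ ‖a - s'‖ * ‖(1 : A)‖ := AlgHom.norm_apply_le_self_mul_norm_one χ _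
      have h4 : ‖a - s'‖ < ε / (‖(1 : A)‖ + 1) := by rw [dist_eq_norm] at hd; exact hd
      have h5 : ‖(a : C(K, ℂ)) ⟨p, hpK⟩ - s ⟨p, hpK⟩‖ ≤ ‖a - s'‖ :=
        ContinuousMap.norm_coe_le_norm ((a : C(K, ℂ)) - s) ⟨p, hpK⟩
      rw [dist_eq_norm]
      rw [map_sub, h2] at h3
      rw [lt_div_iff₀ (by positivity)] at h4
      calc _ = ‖(χ a - s ⟨p, hpK⟩) - ((a : C(K, ℂ)) ⟨p, hpK⟩ - s ⟨p, hpK⟩)‖ := by congr 1; ring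
        _ ≤ _ := norm_sub_le _ _
        _ ≤ ‖a - s'‖ * ‖(1 : A)‖ + ‖a - s'‖ := add_le_add h3 h5
        _ ≤ ε := by linarith
    obtain ⟨i, hi⟩ := hz p hpK
    exact hi ((hev' (Φ i)).symm.trans (hzero' i))
  have h1 : (1 : A) ∈ Ideal.span (range Φ) := by rw [htop]; trivial
  obtain ⟨c, hc⟩ := Ideal.mem_span_range_iff_exists_fun.1 h1
  have hB0 : 0 ≤ ∑ i, ‖Φ0 i‖ := Finset.sum_nonneg fun i _ => norm_nonneg _
  set δ := ε / (1 + ∑ i, ‖Φ0 i‖) with hδ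
  have hδ0 : 0 < δ := by positivity
  have h2 : ∀ i, ∃ V : Set ℂ, IsOpen V ∧ K ⊆ V ∧ ∃ g : ℂ → ℂ, DifferentiableOn ℂ g V ∧
      ∀ z : K, ‖g z - (c i : C(K, ℂ)) z‖ ≤ δ := by
    intro i
    have h1 : (c i : C(K, ℂ)) ∈ closure (S : Set C(K, ℂ)) := (c i).2
    obtain ⟨s, ⟨V, hV, hKV, g, hg, hsg⟩, hd⟩ := Metric.mem_closure_iff.1 h1 δ hδ0
    refine ⟨V, hV, hKV, g, hg, fun z => ?_⟩
    rw [← hsg, ← dist_eq_norm, dist_comm]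
    exact (ContinuousMap.dist_apply_le_dist z).trans hd.le
  choose V hV hKV g hg hgc using h2
  refine ⟨⋂ i, V i, isOpen_iInter_of_finite hV, subset_iInter hKV, g,
    fun i => (hg i).mono (iInter_subset _ i), fun z hz => ?_⟩
  have h3 : ∑ i, (c i : C(K, ℂ)) ⟨z, hz⟩ * φ i z = 1 := by
    have := congrArg (fun a : A => (a : C(K, ℂ)) ⟨z, hz⟩) hc
    simp only [AddSubmonoidClass.coe_finset_sum, ContinuousMap.sum_apply] at this
    exact this
  have h4 : ∑ i, g i z * φ i z - 1 = ∑ i, (g i z - (c i : C(K, ℂ)) ⟨z, hz⟩) * φ i z := by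
    rw [← h3, ← Finset.sum_sub_distrib]
    exact Finset.sum_congr rfl fun i _ => by ring
  rw [h4]
  calc _ ≤ ∑ i, ‖(g i z - (c i : C(K, ℂ)) ⟨z, hz⟩) * φ i z‖ := norm_sum_le _ _
    _ ≤ ∑ i, δ * ‖Φ0 i‖ := by
      refine Finset.sum_le_sum fun i _ => ?_
      rw [norm_mul]
      refine mul_le_mul (hgc i ⟨z, hz⟩) (ContinuousMap.norm_coe_le_norm (Φ0 i) ⟨z, hz⟩)
        (norm_nonneg _) hδ0.le
    _ = δ * ∑ i, ‖Φ0 i‖ := by rw [Finset.mul_sum]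
    _ < δ * (1 + ∑ i, ‖Φ0 i‖) := by
      refine mul_lt_mul_of_pos_left (by linarith) hδ0
    _ = ε := by rw [hδ]; field_simp
end Bezout

section Stein
open Topology

variable {E : Type*} [NormedAddCommGroup E] [NormedSpace ℂ E]

/-- The tube around a curve. -/
def tube (D' : Set ℂ) (F : ℂ → E) (g : ℂ → E →L[ℂ] ℂ) (r : ℝ) : Set E :=
  {x | ∃ z ∈ D', ‖x - F z‖ < r ∧ g z (x - F z) = 0}

lemma tube_local [CompleteSpace E] {D' : Set ℂ} (hD : IsOpen D') {F : ℂ → E}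
    (hF : DifferentiableOn ℂ F D') {g : ℂ → E →L[ℂ] ℂ} (hg : DifferentiableOn ℂ g D') {r : ℝ}
    {z0 : ℂ} {x0 : E} (hz0 : z0 ∈ D') (hx0 : ‖x0 - F z0‖ < r) (hgx : g z0 (x0 - F z0) = 0)
    (hnd : deriv g z0 (x0 - F z0) ≠ g z0 (deriv F z0)) :
    ∃ ψ : E → ℂ, DifferentiableAt ℂ ψ x0 ∧
      ∀ᶠ x in 𝓝 x0, ψ x ∈ D' ∧ ‖x - F (ψ x)‖ < r ∧ g (ψ x) (x - F (ψ x)) = 0 := by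
  have hFz : HasStrictFDerivAt F _ z0 := (hF.analyticOnNhd hD z0 hz0).hasStrictDerivAt
  have hgz : HasStrictFDerivAt g _ z0 := (hg.analyticOnNhd hD z0 hz0).hasStrictDerivAt
  have h1 : HasStrictFDerivAt (fun p : E × ℂ => p.2) (.snd ℂ E ℂ) (x0, z0) := hasStrictFDerivAt_snd
  have h2 : HasStrictFDerivAt (fun p : E × ℂ => p.1) (.fst ℂ E ℂ) (x0, z0) := hasStrictFDerivAt_fst
  have hF2 := HasStrictFDerivAt.comp (x0, z0) (f := fun p : E × ℂ => p.2) hFz h1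
  have hg2 := HasStrictFDerivAt.comp (x0, z0) (f := fun p : E × ℂ => p.2) hgz h1
  obtain ⟨L, hH, hL⟩ : ∃ L : E × ℂ →L[ℂ] ℂ,
      HasStrictFDerivAt (fun p : E × ℂ => g p.2 (p.1 - F p.2)) L (x0, z0) ∧
      ∀ h, L (0, h) = h * (deriv g z0 (x0 - F z0) - g z0 (deriv F z0)) := by
    refine ⟨_, hg2.clm_apply (h2.sub hF2), fun h => ?_⟩
    simp
    ring
  have hinv : (L ∘L .inr ℂ E ℂ).IsInvertible := by
    refine ⟨ContinuousLinearEquiv.unitsEquivAut ℂ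
      (Units.mk0 (deriv g z0 (x0 - F z0) - g z0 (deriv F z0)) (sub_ne_zero.2 hnd)), ?_⟩
    ext
    simp [hL]
  have e1 := (hH.hasStrictFDerivAt_implicitFunctionOfProdDomain hinv).differentiableAt
  have e2 := hH.tendsto_implicitFunctionOfProdDomain hinv
  have e3 := hH.eventually_apply_implicitFunctionOfProdDomain hinv
  set ψ := hH.implicitFunctionOfProdDomain hinv
  refine ⟨ψ, e1, ?_⟩
  simp only at e2 e3
  have hFc : ContinuousAt F z0 := (hF.continuousOn).continuousAt (hD.mem_nhds hz0)
  have e4 : Tendsto (fun x => ‖x - F (ψ x)‖) (𝓝 x0) (𝓝 ‖x0 - F z0‖) :=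
    (tendsto_id.sub (hFc.tendsto.comp e2)).norm
  filter_upwards [e3, e2 (hD.mem_nhds hz0), e4 (Iio_mem_nhds hx0)] with x a1 a2 a3
  exact ⟨a2, a3, a1.trans hgx⟩

lemma tube_isOpen [CompleteSpace E] {D' : Set ℂ} (hD : IsOpen D') {F : ℂ → E}
    (hF : DifferentiableOn ℂ F D') {g : ℂ → E →L[ℂ] ℂ} (hg : DifferentiableOn ℂ g D') {r : ℝ}
    (hnd : ∀ z ∈ D', ∀ y, ‖y‖ < r → g z y = 0 → deriv g z y ≠ g z (deriv F z)) :
    IsOpen (tube D' F g r) := by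
  rw [isOpen_iff_mem_nhds]
  rintro x0 ⟨z0, hz0, h1, h2⟩
  obtain ⟨ψ, -, hψ⟩ := tube_local hD hF hg hz0 h1 h2 (hnd z0 hz0 _ h1 h2)
  filter_upwards [hψ] with x hx
  exact ⟨ψ x, hx⟩

lemma tube_proj [CompleteSpace E] {D' : Set ℂ} (hD : IsOpen D') {F : ℂ → E}
    (hF : DifferentiableOn ℂ F D') {g : ℂ → E →L[ℂ] ℂ} (hg : DifferentiableOn ℂ g D') {r : ℝ}
    (hnd : ∀ z ∈ D', ∀ y, ‖y‖ < r → g z y = 0 → deriv g z y ≠ g z (deriv F z))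
    (hinj : ∀ z1 ∈ D', ∀ z2 ∈ D', ∀ x, ‖x - F z1‖ < r → ‖x - F z2‖ < r → g z1 (x - F z1) = 0 →
      g z2 (x - F z2) = 0 → z1 = z2) :
    ∃ π : E → ℂ, DifferentiableOn ℂ π (tube D' F g r) ∧ ∀ x ∈ tube D' F g r,
      π x ∈ D' ∧ ‖x - F (π x)‖ < r ∧ g (π x) (x - F (π x)) = 0 := by
  choose! π hπ using fun x (hx : x ∈ tube D' F g r) => hx
  refine ⟨π, fun x0 hx0 => ?_, hπ⟩
  obtain ⟨a1, a2, a3⟩ := hπ x0 hx0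
  obtain ⟨ψ, hd, hψ⟩ := tube_local hD hF hg a1 a2 a3 (hnd _ a1 _ a2 a3)
  refine (hd.congr_of_eventuallyEq ?_).differentiableWithinAt
  filter_upwards [hψ, (tube_isOpen hD hF hg hnd).mem_nhds hx0] with x hx hxt
  obtain ⟨b1, b2, b3⟩ := hπ x hxt
  exact hinj _ b1 _ hx.1 x b2 hx.2.1 b3 hx.2.2

lemma tube_stein [ProperSpace E] {D' : Set ℂ} (hD : IsOpen D') (hDb : Bornology.IsBounded D')
    {F : ℂ → E}
    (hF : DifferentiableOn ℂ F D') {g : ℂ → E →L[ℂ] ℂ} (hg : DifferentiableOn ℂ g D') {r : ℝ}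
    (hnd : ∀ z ∈ D', ∀ y, ‖y‖ < r → g z y = 0 → deriv g z y ≠ g z (deriv F z))
    (hinj : ∀ z1 ∈ D', ∀ z2 ∈ D', ∀ x, ‖x - F z1‖ < r → ‖x - F z2‖ < r → g z1 (x - F z1) = 0 →
      g z2 (x - F z2) = 0 → z1 = z2) :
    SteinOpen (tube D' F g r) := by
  obtain ⟨π, hπd, hπ⟩ := tube_proj hD hF hg hnd hinj
  refine ⟨tube_isOpen hD hF hg hnd, fun K hKΩ hK => ?_⟩
  rcases K.eq_empty_or_nonempty with hKe | hKne
  · convert isCompact_empty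
    rw [eq_empty_iff_forall_notMem]
    rintro x ⟨-, hx⟩
    have := hx (fun _ => 1) (differentiableOn_const _)
    rw [hKe] at this
    simp at this
    linarith
  have hπK : IsCompact (π '' K) := hK.image_of_continuousOn (hπd.continuousOn.mono hKΩ)
  have hπKD : π '' K ⊆ D' := by rintro _ ⟨x, hx, rfl⟩; exact (hπ x (hKΩ hx)).1
  obtain ⟨δ, hδ, hδD⟩ := hπK.exists_thickening_subset_open hD hπKD
  have hπD : MapsTo π (tube D' F g r) D' := fun x hx => (hπ x hx).1
  have hFπ : DifferentiableOn ℂ (fun x => x - F (π x)) (tube D' F g r) :=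
    differentiableOn_id.sub (hF.comp hπd hπD)
  obtain ⟨xm, hxm, hmax⟩ := hK.exists_isMaxOn hKne ((hFπ.continuousOn.mono hKΩ).norm)
  set r' := ‖xm - F (π xm)‖ with hr'
  have hr'r : r' < r := (hπ xm (hKΩ hxm)).2.1
  set H := {z ∈ tube D' F g r | ∀ h : E → ℂ, DifferentiableOn ℂ h (tube D' F g r) →
      ‖h z‖ ≤ sSup ((fun w => ‖h w‖) '' K)} with hH
  have hH1 : ∀ x ∈ H, ∀ a, a ∉ D' → δ ≤ ‖π x - a‖ := by
    rintro x ⟨hx, hxh⟩ a ha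
    have hne : ∀ y ∈ tube D' F g r, π y - a ≠ 0 := fun y hy h =>
      ha (by rw [← sub_eq_zero.1 h]; exact hπD hy)
    have := hxh (fun y => (π y - a)⁻¹) ((hπd.sub_const a).inv hne)
    have h2 : sSup ((fun w => ‖(π w - a)⁻¹‖) '' K) ≤ δ⁻¹ := by
      refine csSup_le (hKne.image _) ?_
      rintro _ ⟨w, hw, rfl⟩
      simp only [norm_inv]
      refine inv_anti₀ hδ ?_
      by_contra! hlt
      refine ha (hδD (mem_thickening_iff.2 ⟨π w, mem_image_of_mem _ hw, ?_⟩))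
      rwa [dist_comm, dist_eq_norm]
    have h3 := this.trans h2
    simp only [norm_inv] at h3
    exact (inv_le_inv₀ (norm_pos_iff.2 (hne x hx)) hδ).1 h3
  have hH2 : ∀ x ∈ H, ‖x - F (π x)‖ ≤ r' := by
    rintro x ⟨hx, hxh⟩
    obtain ⟨ℓ, hℓ, hℓx⟩ := exists_dual_vector'' ℂ (x - F (π x))
    have := hxh (fun y => ℓ (y - F (π y))) (ℓ.differentiable.comp_differentiableOn hFπ)
    have h2 : sSup ((fun w => ‖ℓ (w - F (π w))‖) '' K) ≤ r' := by
      refine csSup_le (hKne.image _) ?_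
      rintro _ ⟨w, hw, rfl⟩
      refine (ℓ.le_of_opNorm_le hℓ _).trans ?_
      rw [one_mul]
      exact hmax hw
    have h3 := this.trans h2
    simp only [hℓx] at h3
    simpa using h3
  set Z : Set ℂ := {z ∈ closure D' | ∀ a, a ∉ D' → δ ≤ ‖z - a‖} with hZ
  have hZD : Z ⊆ D' := by
    rintro z ⟨-, hz⟩
    by_contra h
    have := hz z h
    simp at this; linarith
  have hZc : IsCompact Z := by
    refine hDb.isCompact_closure.of_isClosed_subset ?_ (fun z hz => hz.1)
    have : Z = closure D' ∩ ⋂ a, ⋂ (_ : a ∉ D'), {z | δ ≤ ‖z - a‖} := by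
      ext z; simp [hZ]
    rw [this]
    refine isClosed_closure.inter (isClosed_iInter fun a => isClosed_iInter fun _ => ?_)
    exact isClosed_le continuous_const (by fun_prop)
  set T : Set (ℂ × E) := (Z ×ˢ closedBall 0 r') ∩ (fun p => g p.1 p.2) ⁻¹' {0} with hT
  have hTc : IsCompact T := by
    have hc := hZc.prod (isCompact_closedBall (0 : E) r')
    refine hc.of_isClosed_subset ?_ inter_subset_left
    refine ContinuousOn.preimage_isClosed_of_isClosed ?_ hc.isClosed isClosed_singleton
    have : ContinuousOn (fun p : ℂ × E => g p.1) (Z ×ˢ closedBall 0 r') :=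
      (hg.continuousOn.mono hZD).comp continuousOn_fst (fun p hp => hp.1)
    exact this.clm_apply continuousOn_snd
  set Q := (fun p : ℂ × E => F p.1 + p.2) '' T with hQ
  have hQc : IsCompact Q := by
    refine hTc.image_of_continuousOn (ContinuousOn.add ?_ continuousOn_snd)
    exact (hF.continuousOn.mono hZD).comp continuousOn_fst (fun p hp => hp.1.1)
  have hQΩ : Q ⊆ tube D' F g r := by
    rintro _ ⟨⟨z, y⟩, ⟨⟨hz, hy⟩, hgy⟩, rfl⟩
    refine ⟨z, hZD hz, ?_, ?_⟩
    · simp at hy ⊢; linarith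
    · simpa using hgy
  have hHQ : H ⊆ Q := by
    intro x hx
    refine ⟨(π x, x - F (π x)), ⟨⟨⟨subset_closure (hπD hx.1), hH1 x hx⟩, ?_⟩, ?_⟩, by simp⟩
    · simpa using hH2 x hx
    · exact (hπ x hx.1).2.2
  refine hQc.of_isClosed_subset ?_ hHQ
  have hHe : H = Q ∩ ⋂ h : {h : E → ℂ // DifferentiableOn ℂ h (tube D' F g r)},
      (Q ∩ (fun x => ‖h.1 x‖) ⁻¹' Iic (sSup ((fun w => ‖h.1 w‖) '' K))) := by
    ext x
    constructor
    · intro hx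
      exact ⟨hHQ hx, mem_iInter.2 fun h => ⟨hHQ hx, hx.2 h.1 h.2⟩⟩
    · rintro ⟨h1, h2⟩
      exact ⟨hQΩ h1, fun h hh => (mem_iInter.1 h2 ⟨h, hh⟩).2⟩
  rw [hHe]
  refine hQc.isClosed.inter (isClosed_iInter fun h => ?_)
  exact ContinuousOn.preimage_isClosed_of_isClosed (h.2.continuousOn.mono hQΩ).norm
    hQc.isClosed isClosed_Iic
end Stein

section Core
open Topology

variable {E : Type*} [NormedAddCommGroup E] [NormedSpace ℂ E]

lemma seg_est {S : Set ℂ} (hS : IsOpen S) {F : ℂ → E} (hF : DifferentiableOn ℂ F S) {A : E} {ε : ℝ}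
    {z w : ℂ} (hseg : segment ℝ z w ⊆ S) (hb : ∀ v ∈ segment ℝ z w, ‖deriv F v - A‖ ≤ ε) :
    ‖F w - F z - (w - z) • A‖ ≤ ε * ‖w - z‖ := by
  have h := (convex_segment (𝕜 := ℝ) z w).norm_image_sub_le_of_norm_hasDerivWithin_le (𝕜 := ℂ)
    (f := fun v => F v - v • A) (f' := fun v => deriv F v - A) (C := ε) (fun v hv => by
      have h1 : HasDerivAt F (deriv F v) v :=
        ((hF v (hseg hv)).differentiableAt (hS.mem_nhds (hseg hv))).hasDerivAt
      have h2 := h1.sub ((hasDerivAt_id v).smul_const A)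
      exact (h2.congr_deriv (by simp)).hasDerivWithinAt) hb (left_mem_segment ℝ z w)
      (right_mem_segment ℝ z w)
  refine le_trans (le_of_eq ?_) h
  congr 1
  module

lemma inj_modulus {K : Set ℂ} (hK : IsCompact K) {f : ℂ → E} (hf : ContinuousOn f K)
    (hinj : InjOn f K) {η : ℝ} (hη : 0 < η) :
    ∃ ω > 0, ∀ a ∈ K, ∀ b ∈ K, ‖f a - f b‖ < ω → ‖a - b‖ < η := by
  set P : Set (ℂ × ℂ) := (K ×ˢ K) ∩ {p | η ≤ ‖p.1 - p.2‖} with hP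
  have hPc : IsCompact P := (hK.prod hK).inter_right (isClosed_le continuous_const (by fun_prop))
  rcases P.eq_empty_or_nonempty with h | h
  · refine ⟨1, one_pos, fun a ha b hb _ => ?_⟩
    by_contra! hlt
    exact (h ▸ (⟨⟨ha, hb⟩, hlt⟩ : (a, b) ∈ P) : (a, b) ∈ (∅ : Set (ℂ × ℂ)))
  · have hc : ContinuousOn (fun p : ℂ × ℂ => ‖f p.1 - f p.2‖) P :=
      ((hf.comp continuousOn_fst fun p hp => hp.1.1).sub
        (hf.comp continuousOn_snd fun p hp => hp.1.2)).norm
    obtain ⟨p, hp, hmin⟩ := hPc.exists_isMinOn h hc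
    refine ⟨‖f p.1 - f p.2‖, ?_, fun a ha b hb hlt => ?_⟩
    · refine norm_pos_iff.2 (sub_ne_zero.2 fun he => ?_)
      have := hinj hp.1.1 hp.1.2 he
      have h2 := hp.2
      rw [mem_setOf_eq, this] at h2
      simp at h2; linarith
    · by_contra! hge
      exact absurd (hmin (show (a, b) ∈ P from ⟨⟨ha, hb⟩, hge⟩)) (not_le.2 hlt)

set_option maxHeartbeats 4000000 in
lemma main_core [ProperSpace E] {D : Set ℂ} (hDbdd : Bornology.IsBounded D)
    {f f' : ℂ → E} (hfc : ContinuousOn f (closure D)) (hinj : InjOn f (closure D))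
    (hf'c : ContinuousOn f' (closure D))
    {Cq η : ℝ} (hCq : 0 < Cq) (hη : 0 < η)
    (hquasi : ∀ δ ≤ η, ∀ z1 ∈ thickening δ D, ∀ z2 ∈ thickening δ D, ‖z1 - z2‖ < η →
      ∃ w1 w2, segment ℝ z1 w1 ⊆ thickening δ D ∧ segment ℝ w1 w2 ⊆ thickening δ D ∧
        segment ℝ w2 z2 ⊆ thickening δ D ∧ ‖w1 - z1‖ + ‖w2 - w1‖ + ‖z2 - w2‖ ≤ Cq * ‖z1 - z2‖)
    {c C t1 : ℝ} (hc : 0 < c) (hC : 0 < C) (ht1 : 0 < t1)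
    (happ : ∀ t : ℝ, 0 < t → t < t1 → ∃ F : ℂ → E,
      DifferentiableOn ℂ F (thickening (c * t) D) ∧
      (∀ z ∈ closure D, ‖F z - f z‖ ≤ C * t ^ 2) ∧
      ∀ z ∈ thickening (c * t) D, ∃ a ∈ D, ‖z - a‖ ≤ C * t ∧ ‖F z - f a‖ ≤ C * t ∧
        ‖deriv F z - f' a‖ ≤ C * t)
    {V : Set ℂ} (hV : IsOpen V) (hDV : closure D ⊆ V) {g : ℂ → E →L[ℂ] ℂ}
    (hg : DifferentiableOn ℂ g V) (hgf : ∀ z ∈ closure D, ‖g z (f' z) - 1‖ ≤ 1 / 8)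
    {U : Set E} (hU : IsOpen U) (hfU : f '' closure D ⊆ U) :
    ∃ Ω : Set E, SteinOpen Ω ∧ f '' closure D ⊆ Ω ∧ Ω ⊆ U := by
  have hcomp : IsCompact (closure D) := hDbdd.isCompact_closure
  obtain ⟨δ0, hδ0, hδV⟩ := hcomp.exists_cthickening_subset_open hV hDV
  have hK1 : IsCompact (cthickening δ0 (closure D)) := hcomp.cthickening
  have hthV : thickening δ0 D ⊆ cthickening δ0 (closure D) :=
    (thickening_subset_of_subset δ0 subset_closure).trans (thickening_subset_cthickening _ _)
  obtain ⟨Mg, hMg1, hMg⟩ : ∃ Mg : ℝ, 1 ≤ Mg ∧ ∀ z ∈ thickening δ0 D, ‖g z‖ ≤ Mg := by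
    obtain ⟨M, hM⟩ := hK1.exists_bound_of_continuousOn (hg.continuousOn.mono hδV)
    exact ⟨max M 1, le_max_right _ _, fun z hz => (hM z (hthV hz)).trans (le_max_left _ _)⟩
  obtain ⟨Lg, hLg1, hLg⟩ : ∃ Lg : ℝ, 1 ≤ Lg ∧ ∀ z ∈ thickening δ0 D, ‖deriv g z‖ ≤ Lg := by
    obtain ⟨M, hM⟩ := hK1.exists_bound_of_continuousOn
      ((hg.analyticOnNhd hV).deriv.continuousOn.mono hδV)
    exact ⟨max M 1, le_max_right _ _, fun z hz => (hM z (hthV hz)).trans (le_max_left _ _)⟩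
  obtain ⟨M1, hM11, hM1⟩ : ∃ M1 : ℝ, 1 ≤ M1 ∧ ∀ z ∈ closure D, ‖f' z‖ ≤ M1 := by
    obtain ⟨M, hM⟩ := hcomp.exists_bound_of_continuousOn hf'c
    exact ⟨max M 1, le_max_right _ _, fun z hz => (hM z hz).trans (le_max_left _ _)⟩
  have hgd : DifferentiableOn ℂ g (thickening δ0 D) := hg.mono (hthV.trans hδV)
  have hglip : ∀ a ∈ thickening (δ0 / 2) D, ∀ b, ‖b - a‖ < δ0 / 2 → ‖g b - g a‖ ≤ Lg * ‖b - a‖ := by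
    intro a ha b hb
    have hsub : ball a (δ0 / 2) ⊆ thickening δ0 D := by
      intro w hw
      obtain ⟨p, hp, hap⟩ := mem_thickening_iff.1 ha
      refine mem_thickening_iff.2 ⟨p, hp, ?_⟩
      rw [mem_ball] at hw
      linarith [dist_triangle w a p]
    refine (convex_ball a (δ0 / 2)).norm_image_sub_le_of_norm_deriv_le (𝕜 := ℂ)
      (fun x hx => ?_) (fun x hx => hLg x (hsub hx)) (mem_ball_self (by positivity)) (by simpa [dist_eq_norm] using hb)
    exact (hgd x (hsub hx)).differentiableAt (isOpen_thickening.mem_nhds (hsub hx))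
  set ε := 1 / (8 * Mg * Cq) with hε
  have hMg0 : 0 < Mg := by linarith
  have hLg0 : 0 < Lg := by linarith
  have hM10 : 0 < M1 := by linarith
  have hε0 : 0 < ε := by positivity
  have hεMg : Mg * (ε * Cq) = 1 / 8 := by rw [hε]; field_simp
  have hεC : ε * Cq ≤ 1 := by nlinarith [mul_pos hε0 hCq]
  have huc := hcomp.uniformContinuousOn_of_continuous hf'c
  rw [Metric.uniformContinuousOn_iff] at huc
  obtain ⟨ν, hν, huc⟩ := huc (ε / 2) (by positivity)
  obtain ⟨η', hη', hη'η, hη'ν, hη'δ⟩ : ∃ η' > 0, η' ≤ η ∧ Cq * η' ≤ ν / 2 ∧ η' ≤ δ0 / 2 := by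
    refine ⟨min η (min (ν / (2 * Cq)) (δ0 / 2)), by positivity, min_le_left _ _, ?_,
      (min_le_right _ _).trans (min_le_right _ _)⟩
    have : min η (min (ν / (2 * Cq)) (δ0 / 2)) ≤ ν / (2 * Cq) :=
      (min_le_right _ _).trans (min_le_left _ _)
    calc _ ≤ Cq * (ν / (2 * Cq)) := by gcongr
      _ = ν / 2 := by field_simp
  obtain ⟨ω, hω, hmod⟩ := inj_modulus hcomp hfc hinj (half_pos hη')
  obtain ⟨r0, hr0, hr0U⟩ := (hcomp.image_of_continuousOn hfc).exists_thickening_subset_open hU hfU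
  obtain ⟨r, hr, hrr0, hrL, hrω⟩ : ∃ r > 0, r ≤ r0 / 2 ∧ Lg * r ≤ 1 / 8 ∧ r ≤ ω / 4 := by
    refine ⟨min (r0 / 2) (min (1 / (8 * Lg)) (ω / 4)), by positivity, min_le_left _ _, ?_,
      (min_le_right _ _).trans (min_le_right _ _)⟩
    have : min (r0 / 2) (min (1 / (8 * Lg)) (ω / 4)) ≤ 1 / (8 * Lg) :=
      (min_le_right _ _).trans (min_le_left _ _)
    calc _ ≤ Lg * (1 / (8 * Lg)) := by gcongr
      _ = 1 / 8 := by field_simp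
  have hsmall : ∀ a b : ℝ, 0 < b → ∀ᶠ t : ℝ in 𝓝[>] 0, a * t < b := by
    intro a b hb
    have : Tendsto (fun t : ℝ => a * t) (𝓝[>] 0) (𝓝 (a * 0)) :=
      (by fun_prop : Continuous fun t : ℝ => a * t).continuousAt.mono_left nhdsWithin_le_nhds
    rw [mul_zero] at this
    exact this (Iio_mem_nhds hb)
  have hex : ∃ t : ℝ, 0 < t ∧ t < t1 ∧ t < 1 ∧ C * t < ε / 2 ∧ C * t < ν / 4 ∧ Lg * M1 * C * t < 1 / 8 ∧
      C * t < δ0 / 2 ∧ C * t < η' / 4 ∧ C * t < ω / 4 ∧ C * t < r0 / 2 ∧ Mg * C * t < 1 / 8 ∧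
      c * t < δ0 / 2 ∧ c * t < η ∧ Lg * C * t < 1 / 8 ∧ Mg * C * t < c / 8 ∧
      (C + (M1 + 1) * c) * t < r ∧ c * t < η' := by
    have := (((hsmall 1 t1 ht1).and (hsmall 1 1 one_pos)).and ((hsmall C (ε / 2) (by positivity)).and
      (hsmall C (ν / 4) (by positivity)))).and (((hsmall (Lg * M1 * C) (1 / 8) (by positivity)).and
      (hsmall C (δ0 / 2) (by positivity))).and ((hsmall C (η' / 4) (by positivity)).and
      (hsmall C (ω / 4) (by positivity)))) |>.and (((hsmall C (r0 / 2) (by positivity)).and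
      (hsmall (Mg * C) (1 / 8) (by positivity))).and ((hsmall c (δ0 / 2) (by positivity)).and
      (hsmall c η hη))) |>.and (((hsmall (Lg * C) (1 / 8) (by positivity)).and
      (hsmall (Mg * C) (c / 8) (by positivity))).and ((hsmall (C + (M1 + 1) * c) r hr).and
      (hsmall c η' hη'))) |>.and (self_mem_nhdsWithin)
    obtain ⟨t, ht⟩ := this.exists
    simp only [one_mul, mem_Ioi] at ht
    exact ⟨t, by tauto⟩
  obtain ⟨t, ht0, htt1, ht1', h1, h2, h3, h4, h5, h6, h7, h8, h9, h10, h11, h12, h13, h14⟩ := hex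
  obtain ⟨F, hFd, hFf, hFa⟩ := happ t ht0 htt1
  set D' := thickening (c * t) D with hD'
  have hD'o : IsOpen D' := isOpen_thickening
  have hct : 0 < c * t := by positivity
  have htsq : t ^ 2 ≤ t := by nlinarith
  have hD'2 : D' ⊆ thickening (δ0 / 2) D := thickening_mono h9.le _
  have hD'1 : D' ⊆ thickening δ0 D := thickening_mono (by linarith) _
  have hgD' : DifferentiableOn ℂ g D' := hgd.mono hD'1
  have hDth : D ⊆ thickening (δ0 / 2) D := self_subset_thickening (by positivity) D
  choose! α hα hαz hαf hαd using hFa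
  -- `g z (f' (α z))` is close to one
  have hgA : ∀ z ∈ D', ‖g z (f' (α z)) - 1‖ ≤ 1 / 4 := by
    intro z hz
    have e1 := hgf (α z) (subset_closure (hα z hz))
    have e2 := hglip (α z) (hDth (hα z hz)) z ((hαz z hz).trans_lt h4)
    have e3 : ‖(g z - g (α z)) (f' (α z))‖ ≤ Lg * (C * t) * M1 := by
      refine ((g z - g (α z)).le_opNorm _).trans ?_
      gcongr
      · refine e2.trans ?_
        gcongr
        exact hαz z hz
      · exact hM1 _ (subset_closure (hα z hz))
    calc _ = ‖(g z - g (α z)) (f' (α z)) + (g (α z) (f' (α z)) - 1)‖ := by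
          congr 1; simp
      _ ≤ _ := norm_add_le _ _
      _ ≤ Lg * (C * t) * M1 + 1 / 8 := add_le_add e3 e1
      _ ≤ 1 / 4 := by nlinarith
  have hloc : ∀ z1 ∈ D', ∀ z2 ∈ D', ‖z1 - z2‖ < η' →
      ‖F z2 - F z1 - (z2 - z1) • f' (α z1)‖ ≤ ε * Cq * ‖z2 - z1‖ := by
    intro z1 hz1 z2 hz2 hlt
    obtain ⟨w1, w2, s1, s2, s3, hlen⟩ := hquasi (c * t) h10.le z1 hz1 z2 hz2 (hlt.trans_le hη'η)
    have hnear : ∀ w ∈ D', ‖w - z1‖ ≤ Cq * ‖z1 - z2‖ → ‖deriv F w - f' (α z1)‖ ≤ ε := by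
      intro w hw hwz
      have e1 := hαd w hw
      have e2 : dist (α w) (α z1) < ν := by
        have a1 := hαz w hw
        have a2 := hαz z1 hz1
        rw [dist_eq_norm]
        calc ‖α w - α z1‖ = ‖-(w - α w) + (w - z1) + (z1 - α z1)‖ := by congr 1; ring
          _ ≤ ‖-(w - α w)‖ + ‖w - z1‖ + ‖z1 - α z1‖ := norm_add₃_le
          _ < ν := by
            rw [norm_neg]
            have : Cq * ‖z1 - z2‖ ≤ Cq * η' := by gcongr
            linarith
      have e3 := huc _ (subset_closure (hα w hw)) _ (subset_closure (hα z1 hz1)) e2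
      rw [dist_eq_norm] at e3
      calc _ = ‖(deriv F w - f' (α w)) + (f' (α w) - f' (α z1))‖ := by congr 1; abel
        _ ≤ _ := norm_add_le _ _
        _ ≤ ε := by linarith
    have hsegn : ∀ p q v : ℂ, v ∈ segment ℝ p q → ‖v - p‖ ≤ ‖q - p‖ := by
      intro p q v hv
      rw [segment_eq_image'] at hv
      obtain ⟨θ, ⟨hθ0, hθ1⟩, rfl⟩ := hv
      rw [add_sub_cancel_left, norm_smul, Real.norm_of_nonneg hθ0]
      exact mul_le_of_le_one_left (norm_nonneg _) hθ1
    have n1 := norm_nonneg (w1 - z1)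
    have n2 := norm_nonneg (w2 - w1)
    have n3 := norm_nonneg (z2 - w2)
    have b1 := seg_est hD'o hFd s1 (A := f' (α z1)) (ε := ε) (fun v hv => hnear v (s1 hv) (by
      linarith [hsegn _ _ _ hv]))
    have b2 := seg_est hD'o hFd s2 (A := f' (α z1)) (ε := ε) (fun v hv => hnear v (s2 hv) (by
      have : ‖v - z1‖ ≤ ‖v - w1‖ + ‖w1 - z1‖ := by
        simpa using norm_sub_le_norm_sub_add_norm_sub v w1 z1
      linarith [hsegn _ _ _ hv]))
    have b3 := seg_est hD'o hFd s3 (A := f' (α z1)) (ε := ε) (fun v hv => hnear v (s3 hv) (by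
      have : ‖v - z1‖ ≤ ‖v - w2‖ + ‖w2 - z1‖ := by
        simpa using norm_sub_le_norm_sub_add_norm_sub v w2 z1
      have : ‖w2 - z1‖ ≤ ‖w2 - w1‖ + ‖w1 - z1‖ := by
        simpa using norm_sub_le_norm_sub_add_norm_sub w2 w1 z1
      linarith [hsegn _ _ _ hv]))
    have e : F z2 - F z1 - (z2 - z1) • f' (α z1) = (F w1 - F z1 - (w1 - z1) • f' (α z1)) +
        (F w2 - F w1 - (w2 - w1) • f' (α z1)) + (F z2 - F w2 - (z2 - w2) • f' (α z1)) := by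
      module
    rw [e]
    calc _ ≤ _ := norm_add₃_le
      _ ≤ ε * ‖w1 - z1‖ + ε * ‖w2 - w1‖ + ε * ‖z2 - w2‖ := by linarith
      _ = ε * (‖w1 - z1‖ + ‖w2 - w1‖ + ‖z2 - w2‖) := by ring
      _ ≤ ε * (Cq * ‖z1 - z2‖) := by gcongr
      _ = _ := by rw [norm_sub_rev z1 z2]; ring
  have hlocg : ∀ z1 ∈ D', ∀ z2 ∈ D', ‖z1 - z2‖ < η' →
      5 / 8 * ‖z2 - z1‖ ≤ ‖g z1 (F z2 - F z1)‖ := by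
    intro z1 hz1 z2 hz2 hlt
    have e1 := hloc z1 hz1 z2 hz2 hlt
    have e2 : ‖g z1 (F z2 - F z1 - (z2 - z1) • f' (α z1))‖ ≤ Mg * (ε * Cq * ‖z2 - z1‖) :=
      (g z1).le_of_opNorm_le_of_le (hMg z1 (hD'1 hz1)) e1
    have e3 : ‖(z2 - z1) * (g z1 (f' (α z1)) - 1)‖ ≤ ‖z2 - z1‖ * (1 / 4) := by
      rw [norm_mul]
      gcongr
      exact hgA z1 hz1
    have e4 : z2 - z1 = g z1 (F z2 - F z1) - g z1 (F z2 - F z1 - (z2 - z1) • f' (α z1))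
        - (z2 - z1) * (g z1 (f' (α z1)) - 1) := by
      rw [map_sub (g z1) (F z2 - F z1), map_smul, smul_eq_mul]; ring
    have e5 : ‖z2 - z1‖ ≤ ‖g z1 (F z2 - F z1)‖ + ‖g z1 (F z2 - F z1 - (z2 - z1) • f' (α z1))‖ +
        ‖(z2 - z1) * (g z1 (f' (α z1)) - 1)‖ := by
      conv_lhs => rw [e4]
      exact (norm_sub_le _ _).trans (add_le_add_left (norm_sub_le _ _) _)
    have e6 : Mg * (ε * Cq * ‖z2 - z1‖) = 1 / 8 * ‖z2 - z1‖ := by rw [← hεMg]; ring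
    linarith
  refine ⟨tube D' F g r, tube_stein hD'o hDbdd.thickening hFd hgD' ?_ ?_, ?_, ?_⟩
  · -- nondegeneracy
    intro z hz y hy hgy heq
    have e1 := hgA z hz
    have e2 : ‖g z (deriv F z - f' (α z))‖ ≤ Mg * (C * t) :=
      (g z).le_of_opNorm_le_of_le (hMg z (hD'1 hz)) (hαd z hz)
    have e3 : ‖deriv g z y‖ ≤ Lg * r :=
      (deriv g z).le_of_opNorm_le_of_le (hLg z (hD'1 hz)) hy.le
    have e4 : (1 : ℂ) = g z (deriv F z) - g z (deriv F z - f' (α z)) - (g z (f' (α z)) - 1) := by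
      rw [map_sub]; ring
    have e5 : ‖(1 : ℂ)‖ ≤ ‖g z (deriv F z)‖ + ‖g z (deriv F z - f' (α z))‖ +
        ‖g z (f' (α z)) - 1‖ := by
      conv_lhs => rw [e4]
      exact (norm_sub_le _ _).trans (add_le_add_left (norm_sub_le _ _) _)
    rw [← heq, norm_one] at e5
    linarith
  · -- injectivity
    intro z1 hz1 z2 hz2 x hx1 hx2 hg1 hg2
    have e1 : ‖f (α z1) - f (α z2)‖ < ω := by
      have a1 := hαf z1 hz1
      have a2 := hαf z2 hz2
      have : f (α z1) - f (α z2) = -(F z1 - f (α z1)) - (x - F z1) + (x - F z2) + (F z2 - f (α z2)) := by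
        abel
      rw [this]
      calc _ ≤ ‖-(F z1 - f (α z1)) - (x - F z1)‖ + ‖x - F z2‖ + ‖F z2 - f (α z2)‖ := norm_add₃_le
        _ ≤ ‖-(F z1 - f (α z1))‖ + ‖x - F z1‖ + ‖x - F z2‖ + ‖F z2 - f (α z2)‖ := by
          gcongr; exact norm_sub_le _ _
        _ < ω := by rw [norm_neg]; linarith
    have e2 := hmod _ (subset_closure (hα z1 hz1)) _ (subset_closure (hα z2 hz2)) e1
    have e3 : ‖z1 - z2‖ < η' := by
      have a1 := hαz z1 hz1
      have a2 := hαz z2 hz2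
      calc ‖z1 - z2‖ = ‖(z1 - α z1) + (α z1 - α z2) + -(z2 - α z2)‖ := by congr 1; ring
        _ ≤ ‖z1 - α z1‖ + ‖α z1 - α z2‖ + ‖-(z2 - α z2)‖ := norm_add₃_le
        _ < η' := by rw [norm_neg]; linarith
    have e4 := hlocg z1 hz1 z2 hz2 e3
    have e5 : g z1 (F z2 - F z1) = (g z2 - g z1) (x - F z2) := by
      have : F z2 - F z1 = (x - F z1) - (x - F z2) := by abel
      rw [this, map_sub, hg1, sub_apply, hg2]
    have e6 := hglip z1 (hD'2 hz1) z2 (by rw [norm_sub_rev]; linarith)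
    have e7 : ‖(g z2 - g z1) (x - F z2)‖ ≤ Lg * ‖z2 - z1‖ * r :=
      (g z2 - g z1).le_of_opNorm_le_of_le e6 hx2.le
    rw [e5] at e4
    have e8 : Lg * ‖z2 - z1‖ * r ≤ 1 / 8 * ‖z2 - z1‖ := by nlinarith [norm_nonneg (z2 - z1)]
    have e9 : ‖z2 - z1‖ ≤ 0 := by linarith
    exact (sub_eq_zero.1 (norm_le_zero_iff.1 e9)).symm
  · -- the curve is in the tube
    rintro _ ⟨z0, hz0, rfl⟩
    set ρ := c * t / 2 with hρ
    have hρ0 : 0 < ρ := by positivity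
    have hball : closedBall z0 ρ ⊆ D' := by
      intro z hz
      rw [hD', ← thickening_closure]
      refine mem_thickening_iff.2 ⟨z0, hz0, ?_⟩
      rw [mem_closedBall] at hz
      linarith
    have hz0D : z0 ∈ D' := hball (mem_closedBall_self hρ0.le)
    have hxF : ‖f z0 - F z0‖ ≤ C * t ^ 2 := by rw [norm_sub_rev]; exact hFf z0 hz0
    have hCt2 : C * t ^ 2 ≤ C * t := by gcongr
    set H : ℂ → ℂ := fun z => g z (f z0 - F z) with hH
    have hHd : DifferentiableOn ℂ H D' := hgD'.clm_apply ((differentiableOn_const _).sub hFd)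
    have hHdc : DiffContOnCl ℂ H (ball z0 ρ) := by
      refine DifferentiableOn.diffContOnCl (hHd.mono ?_)
      rwa [closure_ball _ hρ0.ne']
    have hlow : ∀ z ∈ closedBall z0 ρ, 1 / 2 * ‖z - z0‖ ≤ ‖H z - H z0‖ := by
      intro z hz
      have hzn : ‖z - z0‖ ≤ ρ := by simpa [dist_eq_norm] using hz
      have a1 := hlocg z (hball hz) z0 hz0D (by linarith)
      have a2 := hglip z0 (hD'2 hz0D) z (by linarith)
      have a3 : ‖(g z - g z0) (f z0 - F z0)‖ ≤ Lg * ‖z - z0‖ * (C * t ^ 2) :=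
        (g z - g z0).le_of_opNorm_le_of_le a2 hxF
      have a4 : Lg * ‖z - z0‖ * (C * t ^ 2) ≤ 1 / 8 * ‖z - z0‖ := by
        calc _ ≤ Lg * ‖z - z0‖ * (C * t) := by gcongr
          _ = (Lg * C * t) * ‖z - z0‖ := by ring
          _ ≤ _ := by gcongr
      have a5 : g z (F z0 - F z) = (H z - H z0) - (g z - g z0) (f z0 - F z0) := by
        simp only [hH, map_sub, sub_apply]; ring
      rw [a5, norm_sub_rev z0 z] at a1
      have a6 := norm_sub_le (H z - H z0) ((g z - g z0) (f z0 - F z0))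
      linarith
    have himg := hHdc.ball_subset_image_closedBall hρ0 (ε := 1 / 2 * ρ) (fun z hz => by
      have := hlow z (sphere_subset_closedBall hz)
      rwa [← dist_eq_norm z z0, mem_sphere.1 hz] at this) (by
      have hev : ∀ᶠ z in 𝓝[≠] z0, H z ≠ H z0 := by
        filter_upwards [self_mem_nhdsWithin, nhdsWithin_le_nhds (closedBall_mem_nhds z0 hρ0)]
          with z hz hzb heq
        have := hlow z hzb
        rw [heq, sub_self, norm_zero] at this
        have : 0 < ‖z - z0‖ := norm_pos_iff.2 (sub_ne_zero.2 hz)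
        linarith
      exact hev.frequently.filter_mono nhdsWithin_le_nhds)
    have h0 : (0 : ℂ) ∈ ball (H z0) (1 / 2 * ρ / 2) := by
      rw [mem_ball, dist_eq_norm, zero_sub, norm_neg]
      have : ‖H z0‖ ≤ Mg * (C * t ^ 2) :=
        (g z0).le_of_opNorm_le_of_le (hMg z0 (hD'1 hz0D)) hxF
      nlinarith
    obtain ⟨z, hz, hHz⟩ := himg h0
    refine ⟨z, hball hz, ?_, hHz⟩
    have hzn : ‖z - z0‖ ≤ ρ := by simpa [dist_eq_norm] using hz
    have b1 := hloc z (hball hz) z0 hz0D (by linarith)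
    have b2 : ‖F z0 - F z‖ ≤ (M1 + 1) * ρ := by
      have : F z0 - F z = (F z0 - F z - (z0 - z) • f' (α z)) + (z0 - z) • f' (α z) := by abel
      rw [this]
      refine (norm_add_le _ _).trans ?_
      rw [norm_smul]
      rw [norm_sub_rev z0 z] at b1 ⊢
      have a1 := hM1 _ (subset_closure (hα z (hball hz)))
      calc _ ≤ 1 * ρ + ρ * M1 := by
            refine add_le_add (b1.trans ?_) ?_
            · gcongr
            · gcongr
        _ = _ := by ring
    calc ‖f z0 - F z‖ = ‖(f z0 - F z0) + (F z0 - F z)‖ := by congr 1; abel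
      _ ≤ ‖f z0 - F z0‖ + ‖F z0 - F z‖ := norm_add_le _ _
      _ ≤ C * t + (M1 + 1) * ρ := add_le_add (hxF.trans hCt2) b2
      _ < r := by nlinarith
  · rintro x ⟨z, hz, hx, -⟩
    refine hr0U (mem_thickening_iff.2 ⟨f (α z), mem_image_of_mem _ (subset_closure (hα z hz)), ?_⟩)
    rw [dist_eq_norm]
    calc ‖x - f (α z)‖ = ‖(x - F z) + (F z - f (α z))‖ := by congr 1; abel
      _ ≤ _ := norm_add_le _ _
      _ < r0 := by linarith [hαf z hz]
end Core

/-- A smoothly bounded complex curve `f(D̄)` embedded in `ℂ^N` has a basis of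
open Stein neighborhoods. -/
theorem stein_neighborhood_basis_of_embedded_curve
    (N : ℕ) (hN : 1 ≤ N)
    (D : Set ℂ) (hDopen : IsOpen D) (hDbdd : Bornology.IsBounded D)
    (hDconn : IsConnected D) (hDsb : SmoothlyBounded D)
    (f : ℂ → Cn N) (hinj : InjOn f (closure D)) (hf : ClassA 2 D f)
    (f' : ℂ → Cn N) (hf'cont : ContinuousOn f' (closure D))
    (hf'eq : EqOn f' (deriv f) D)
    (hf'ne : ∀ z ∈ closure D, f' z ≠ 0) :
    ∀ U : Set (Cn N), IsOpen U → f '' closure D ⊆ U →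
      ∃ Ω : Set (Cn N), SteinOpen Ω ∧ f '' closure D ⊆ Ω ∧ Ω ⊆ U := by
  intro U hU hfU
  have hcomp : IsCompact (closure D) := hDbdd.isCompact_closure
  obtain ⟨hfc, hfd, hfk⟩ := hf
  obtain ⟨n, hn, κ, hκ, s0, hs0, hcone⟩ := exists_cone hDopen hDbdd hDsb
  obtain ⟨Cq, hCq, η, hη, hquasi⟩ := exists_quasiconvex hDbdd hn.continuous hκ hs0 hcone
  obtain ⟨M1, hM1⟩ := hcomp.exists_bound_of_continuousOn hf'cont
  obtain ⟨f2, hf2c, hf2⟩ := hfk 2 le_rfl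
  obtain ⟨M2, hM2⟩ := hcomp.exists_bound_of_continuousOn hf2c
  obtain ⟨c, hc, C, hC, t1, ht1, happ0⟩ := exists_approximants hDopen hDbdd hn hκ hs0 hcone hfc hfd
    (le_max_right M1 0) (le_max_right M2 0) (fun z hz => by
      rw [← hf'eq hz]; exact (hM1 z (subset_closure hz)).trans (le_max_left _ _)) (fun z hz => by
      have := hf2 hz
      rw [iteratedDeriv_succ, iteratedDeriv_one] at this
      rw [← this]; exact (hM2 z (subset_closure hz)).trans (le_max_left _ _))
  have happ : ∀ t : ℝ, 0 < t → t < t1 → ∃ F : ℂ → Cn N,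
      DifferentiableOn ℂ F (thickening (c * t) D) ∧
      (∀ z ∈ closure D, ‖F z - f z‖ ≤ C * t ^ 2) ∧
      ∀ z ∈ thickening (c * t) D, ∃ a ∈ D, ‖z - a‖ ≤ C * t ∧ ‖F z - f a‖ ≤ C * t ∧
        ‖deriv F z - f' a‖ ≤ C * t := by
    intro t h0 h1
    obtain ⟨F, hF1, hF2, hF3⟩ := happ0 t h0 h1
    refine ⟨F, hF1, hF2, fun z hz => ?_⟩
    obtain ⟨a, ha, b1, b2, b3⟩ := hF3 z hz
    exact ⟨a, ha, b1, b2, by rwa [hf'eq ha]⟩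
  have huc := hcomp.uniformContinuousOn_of_continuous hf'cont
  rw [Metric.uniformContinuousOn_iff] at huc
  obtain ⟨V, hV, hDV, g, hg, hgf⟩ := exists_bezout hcomp (fun i z => f' z i)
    (fun i => (EuclideanSpace.proj (𝕜 := ℂ) i).continuous.comp_continuousOn hf'cont)
    (fun i ε hε => by
      obtain ⟨ν, hν, huc⟩ := huc (ε / 2) (by positivity)
      set t := min (t1 / 2) (min (ε / (2 * C)) (ν / (2 * C))) with ht
      have ht0 : 0 < t := by positivity
      have htt1 : t < t1 := (min_le_left _ _).trans_lt (half_lt_self ht1)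
      have hte : C * t ≤ ε / 2 := by
        have : t ≤ ε / (2 * C) := (min_le_right _ _).trans (min_le_left _ _)
        calc C * t ≤ C * (ε / (2 * C)) := by gcongr
          _ = ε / 2 := by field_simp
      have htn : C * t ≤ ν / 2 := by
        have : t ≤ ν / (2 * C) := (min_le_right _ _).trans (min_le_right _ _)
        calc C * t ≤ C * (ν / (2 * C)) := by gcongr
          _ = ν / 2 := by field_simp
      obtain ⟨F, hF1, -, hF3⟩ := happ t ht0 htt1
      have hcl : closure D ⊆ thickening (c * t) D := by
        rw [closure_eq_iInter_thickening]
        exact iInter₂_subset (c * t) (by positivity)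
      refine ⟨thickening (c * t) D, isOpen_thickening, hcl, fun z => deriv F z i, ?_, ?_⟩
      · exact (EuclideanSpace.proj (𝕜 := ℂ) i).differentiable.comp_differentiableOn
          (hF1.deriv isOpen_thickening)
      · intro z hz
        obtain ⟨a, ha, b1, -, b3⟩ := hF3 z (hcl hz)
        have b4 := huc a (subset_closure ha) z hz (by
          rw [dist_comm, dist_eq_norm]; linarith)
        rw [dist_eq_norm] at b4
        calc ‖deriv F z i - f' z i‖ = ‖(deriv F z - f' z) i‖ := by simp
          _ ≤ ‖deriv F z - f' z‖ := PiLp.norm_apply_le _ i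
          _ = ‖(deriv F z - f' a) + (f' a - f' z)‖ := by congr 1; abel
          _ ≤ _ := norm_add_le _ _
          _ ≤ ε := by linarith)
    (fun z hz => by
      by_contra! h
      exact hf'ne z hz (by ext i; simpa using h i)) (ε := 1 / 8) (by norm_num)
  refine main_core hDbdd hfc hinj hf'cont hCq hη hquasi hc hC ht1 happ hV hDV
    (g := fun z => ∑ i, g i z • EuclideanSpace.proj (𝕜 := ℂ) i) ?_ ?_ hU hfU
  · exact DifferentiableOn.fun_sum fun i _ => (hg i).smul_const _
  · intro z hz
    have := (hgf z hz).le
    simpa [ContinuousLinearMap.sum_apply] using this
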